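/- arXiv:2510.03062 — 2 statements merged into one kernel-verified Lean document; each statement's English description precedes it below -/
import Mathlib

section
/- (Transformed potentials of the N-fold Darboux transformation.) Under the N-fold Darboux recursion with M invertible, define u_N = u + 2i det(M₁)/det(M), v_N = v + 2i det(M₂)/det(M), w_N = w + 2i det(M₃)/det(M), where, writing Ψ_i = (φ_i, ϕ_i, ψ_i, χ_i)ᵀ, the matrix M₁ (resp. M₂, M₃) is the (N+1)×(N+1) matrix obtained from M by appending the column (ϕ₁*, …, ϕ_N*)ᵀ (resp. (ψ₁*, …, ψ_N*)ᵀ, (χ₁*, …, χ_N*)ᵀ) on the right and the row (φ₁, …, φ_N, 0) at the bottom. Then for every ζ outside {ζ₁*, …, ζ_N*}, ∂_x T_N(ζ) + T_N(ζ)U(ζ) = U_N(ζ)T_N(ζ) and ∂_t T_N(ζ) + T_N(ζ)V(ζ) = V_N(ζ)T_N(ζ), where U_N, V_N are the Lax matrices built from (u_N, v_N, w_N); in particular (u_N, v_N, w_N) is a solution of the vcmKdV equation. -/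
open Matrix Filter Topology

noncomputable section

/-- Partial derivative in the first (space) variable. -/
def dX (f : ℝ × ℝ → ℂ) : ℝ × ℝ → ℂ := fun p => deriv (fun x => f (x, p.2)) p.1

/-- Partial derivative in the second (time) variable. -/
def dT (f : ℝ × ℝ → ℂ) : ℝ × ℝ → ℂ := fun p => deriv (fun t => f (p.1, t)) p.2

/-- Left-hand side of one component of the vcmKdV equation
`f_t + f_xxx + 3((q†q) f_x + (q†q_x) f)` for `q = (u,v,w)ᵀ`. -/
def vcmLHS (u v w f : ℝ × ℝ → ℂ) (p : ℝ × ℝ) : ℂ :=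
  dT f p + dX (dX (dX f)) p
    + 3 * (((starRingEnd ℂ) (u p) * u p + (starRingEnd ℂ) (v p) * v p
            + (starRingEnd ℂ) (w p) * w p) * dX f p
         + ((starRingEnd ℂ) (u p) * dX u p + (starRingEnd ℂ) (v p) * dX v p
            + (starRingEnd ℂ) (w p) * dX w p) * f p)

/-- The vector complex modified KdV equation
`q_t + q_xxx + 3(q_x q† q + q q† q_x) = 0` for `q = (u,v,w)ᵀ`. -/
def vcmKdVeq (u v w : ℝ × ℝ → ℂ) : Prop :=
  ∀ p : ℝ × ℝ, vcmLHS u v w u p = 0 ∧ vcmLHS u v w v p = 0 ∧ vcmLHS u v w w p = 0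

/-- `J = diag(1, -1, -1, -1)`. -/
def Jmat : Matrix (Fin 4) (Fin 4) ℂ := Matrix.diagonal ![1, -1, -1, -1]

/-- The potential matrix `Q` built from the entries `u, v, w`. -/
def Qmat (u v w : ℂ) : Matrix (Fin 4) (Fin 4) ℂ :=
  !![0, u, v, w;
     -((starRingEnd ℂ) u), 0, 0, 0;
     -((starRingEnd ℂ) v), 0, 0, 0;
     -((starRingEnd ℂ) w), 0, 0, 0]

/-- `U(ζ) = -iζJ + Q`. -/
def Umat (ζ u v w : ℂ) : Matrix (Fin 4) (Fin 4) ℂ :=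
  (-Complex.I * ζ) • Jmat + Qmat u v w

/-- `V(ζ) = -4iζ³J + 4ζ²Q - 2iζ(Q² + Q_x)J + (-Q_xx + 2Q³ + Q_x Q - Q Q_x)`. -/
def Vmat (ζ u v w ux vx wx uxx vxx wxx : ℂ) : Matrix (Fin 4) (Fin 4) ℂ :=
  (-4 * Complex.I * ζ ^ 3) • Jmat + (4 * ζ ^ 2) • Qmat u v w
    - (2 * Complex.I * ζ) • ((Qmat u v w ^ 2 + Qmat ux vx wx) * Jmat)
    + (-Qmat uxx vxx wxx + 2 * Qmat u v w ^ 3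
        + Qmat ux vx wx * Qmat u v w - Qmat u v w * Qmat ux vx wx)

/-- `U(ζ)` as a matrix-valued field on `ℝ²`. -/
def Ufield (u v w : ℝ × ℝ → ℂ) (ζ : ℂ) (p : ℝ × ℝ) : Matrix (Fin 4) (Fin 4) ℂ :=
  Umat ζ (u p) (v p) (w p)

/-- `V(ζ)` as a matrix-valued field on `ℝ²` (with `Q_x`, `Q_xx` the entrywise derivatives). -/
def Vfield (u v w : ℝ × ℝ → ℂ) (ζ : ℂ) (p : ℝ × ℝ) : Matrix (Fin 4) (Fin 4) ℂ :=
  Vmat ζ (u p) (v p) (w p) (dX u p) (dX v p) (dX w p)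
    (dX (dX u) p) (dX (dX v) p) (dX (dX w) p)

/-- Entrywise `x`-derivative of a matrix-valued field. -/
def dXM (F : ℝ × ℝ → Matrix (Fin 4) (Fin 4) ℂ) (p : ℝ × ℝ) : Matrix (Fin 4) (Fin 4) ℂ :=
  Matrix.of fun i j => deriv (fun x => F (x, p.2) i j) p.1

/-- Entrywise `t`-derivative of a matrix-valued field. -/
def dTM (F : ℝ × ℝ → Matrix (Fin 4) (Fin 4) ℂ) (p : ℝ × ℝ) : Matrix (Fin 4) (Fin 4) ℂ :=
  Matrix.of fun i j => deriv (fun t => F (p.1, t) i j) p.2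

/-- `Ψ` solves the Lax pair `Ψ_x = U(ζ)Ψ`, `Ψ_t = V(ζ)Ψ` with potentials `(u,v,w)`. -/
def SolvesLax (u v w : ℝ × ℝ → ℂ) (ζ : ℂ) (Ψ : ℝ × ℝ → Fin 4 → ℂ) : Prop :=
  ∀ p : ℝ × ℝ,
    HasDerivAt (fun x => Ψ (x, p.2)) ((Ufield u v w ζ p).mulVec (Ψ p)) p.1 ∧
    HasDerivAt (fun t => Ψ (p.1, t)) ((Vfield u v w ζ p).mulVec (Ψ p)) p.2

/-- The rank-one projection `ψψ†/(ψ†ψ)`. -/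
def projOf (ψ : Fin 4 → ℂ) : Matrix (Fin 4) (Fin 4) ℂ :=
  (star ψ ⬝ᵥ ψ)⁻¹ • vecMulVec ψ (star ψ)

/-- One-fold Darboux matrix `T(ζ) = I - ((ζ₁ - ζ₁*)/(ζ - ζ₁*)) ψψ†/(ψ†ψ)`. -/
def Tone (ζ₁ ζ : ℂ) (ψ : Fin 4 → ℂ) : Matrix (Fin 4) (Fin 4) ℂ :=
  1 - ((ζ₁ - (starRingEnd ℂ) ζ₁) / (ζ - (starRingEnd ℂ) ζ₁)) • projOf ψ

/-- Transformed potential `f - 2i(ζ₁ - ζ₁*) Ψ₁⁰ (Ψ₁ʲ)* / (Ψ₁†Ψ₁)` of the one-fold DT. -/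
def u1of (f : ℝ × ℝ → ℂ) (ζ₁ : ℂ) (Ψ₁ : ℝ × ℝ → Fin 4 → ℂ) (j : Fin 4) : ℝ × ℝ → ℂ :=
  fun p => f p - 2 * Complex.I * (ζ₁ - (starRingEnd ℂ) ζ₁) * Ψ₁ p 0
      * (starRingEnd ℂ) (Ψ₁ p j) / (star (Ψ₁ p) ⬝ᵥ Ψ₁ p)

/-- The iterated eigenfunctions `Ψ_i^{(k)}` of the `N`-fold Darboux recursion
(0-based indexing: `PsiIter ζs Ψs k i = Ψ_{i+1}^{(k)}`). -/
def PsiIter (ζs : ℕ → ℂ) (Ψs : ℕ → ℝ × ℝ → Fin 4 → ℂ) : ℕ → ℕ → ℝ × ℝ → Fin 4 → ℂ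
  | 0, i => Ψs i
  | k + 1, i => fun p =>
      (Tone (ζs k) (ζs i) (PsiIter ζs Ψs k k p)).mulVec (PsiIter ζs Ψs k i p)

/-- The product `T_N(ζ) = T[N](ζ) ⋯ T[1](ζ)` of the `N`-fold Darboux recursion. -/
def TNmat (ζs : ℕ → ℂ) (Ψs : ℕ → ℝ × ℝ → Fin 4 → ℂ) :
    ℕ → ℂ → ℝ × ℝ → Matrix (Fin 4) (Fin 4) ℂ
  | 0, _, _ => 1
  | k + 1, ζ, p => Tone (ζs k) ζ (PsiIter ζs Ψs k k p) * TNmat ζs Ψs k ζ p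

/-- The explicit eigenfunction of the Lax pair for the zero seed at eigenvalue `ζk`. -/
def seedPsi (ζk : ℂ) (c₁ c₂ c₃ : ℝ) (p : ℝ × ℝ) : Fin 4 → ℂ :=
  ![Complex.exp (-Complex.I * ζk * (4 * p.2 * ζk ^ 2 + p.1)),
    c₁ * Complex.exp (Complex.I * ζk * (4 * p.2 * ζk ^ 2 + p.1)),
    c₂ * Complex.exp (Complex.I * ζk * (4 * p.2 * ζk ^ 2 + p.1)),
    c₃ * Complex.exp (Complex.I * ζk * (4 * p.2 * ζk ^ 2 + p.1))]

/-- The `N×N` matrix `M` with entries `M_{jk} = Ψ_j†Ψ_k/(ζ_k - ζ_j*)`. -/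
def MmatOf {N : ℕ} (ζs : Fin N → ℂ) (Ψs : Fin N → ℝ × ℝ → Fin 4 → ℂ) (p : ℝ × ℝ) :
    Matrix (Fin N) (Fin N) ℂ :=
  Matrix.of fun j k => (star (Ψs j p) ⬝ᵥ Ψs k p) / (ζs k - (starRingEnd ℂ) (ζs j))

/-- The `4×N` matrix `X = (Ψ₁, …, Ψ_N)` whose columns are the eigenfunctions. -/
def XmatOf {N : ℕ} (Ψs : Fin N → ℝ × ℝ → Fin 4 → ℂ) (p : ℝ × ℝ) :
    Matrix (Fin 4) (Fin N) ℂ :=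
  Matrix.of fun a j => Ψs j p a

/-- `M` bordered on the right by the column `c` and at the bottom by the row `(r, 0)`. -/
def bordered {N : ℕ} (M : Matrix (Fin N) (Fin N) ℂ) (c r : Fin N → ℂ) :
    Matrix (Fin (N + 1)) (Fin (N + 1)) ℂ :=
  Matrix.of fun i j =>
    Fin.lastCases
      (Fin.lastCases (0 : ℂ) (fun j' => r j') j)
      (fun i' => Fin.lastCases (c i') (fun j' => M i' j') j)
      i

section Algebra

variable {A : Type*} [Ring A]

theorem dressed_V0 {K D O Q Qx Qxx Q₁ Q₁x Q₁xx : A} (hK : K * K = -1)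
    (hD : K * D = D * K) (hO : K * O = -(O * K)) (hQ : K * Q = -(Q * K))
    (hQx : K * Qx = -(Qx * K))
    (h₁ : Q₁ = Q + 2 * (O * K)) (h₁x : Q₁x = Qx + 2 * ((Q₁ * D - D * Q) * K))
    (h₁xx : Q₁xx = Qxx + 2 * ((Q₁x * D + Q₁ * (Q₁ * O - O * Q)
      - (Q₁ * O - O * Q) * Q - D * Qx) * K)) :
    -Q₁xx + 2 * Q₁ ^ 3 + Q₁x * Q₁ - Q₁ * Q₁x
      = (-Qxx + 2 * Q ^ 3 + Qx * Q - Q * Qx) - (D + O) * (-(2 * ((Q ^ 2 + Qx) * K)))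
        + -(2 * ((Q₁ ^ 2 + Q₁x) * K)) * (D + O) := by
  have move {X e : A} (h : K * X = e) (Y : A) : K * (X * Y) = e * Y := by
    rw [← mul_assoc, h]
  have hD' := move hD
  have hO' := move hO
  have hQ' := move hQ
  subst h₁xx h₁x h₁
  simp only [pow_succ, pow_zero, one_mul, two_mul, mul_assoc, mul_add, add_mul, mul_sub, sub_mul,
    neg_mul, mul_neg, hK, hD, hO, hQ, hQx, hD', hO', hQ', mul_one, neg_neg, neg_add, neg_sub]
  abel

theorem dressed_V1 {K D O Q Qx Q₁ Q₁x : A} (hK : K * K = -1)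
    (hD : K * D = D * K) (hO : K * O = -(O * K)) (hQ : K * Q = -(Q * K))
    (h₁ : Q₁ = Q + 2 * (O * K)) (h₁x : Q₁x = Qx + 2 * ((Q₁ * D - D * Q) * K)) :
    -(2 * ((Q₁ ^ 2 + Q₁x) * K))
      = -(2 * ((Q ^ 2 + Qx) * K)) - (D + O) * (4 * Q) + 4 * Q₁ * (D + O) := by
  have move {X e : A} (h : K * X = e) (Y : A) : K * (X * Y) = e * Y := by
    rw [← mul_assoc, h]
  have hO' := move hO
  have h4 : (4 : A) = 1 + 1 + 1 + 1 := by norm_num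
  subst h₁x h₁
  simp only [pow_succ, pow_zero, one_mul, two_mul, mul_assoc, mul_add, add_mul, mul_sub, sub_mul,
    neg_mul, mul_neg, hK, hD, hO, hQ, hO', mul_one, neg_neg, neg_add, neg_sub, h4]
  abel

/-- The zero-order part of the zero-curvature expression is invariant under dressing. -/
theorem dressed_curvature {K H Q Q₁ Qt Q₁t Hx V₀ V₁ W₀ W₁ V₀x V₁x W₀x W₁x : A}
    (h₁ : Q₁ = Q + (H * K - K * H)) (hHx : Hx = Q₁ * H - H * Q)
    (hW₀ : W₀ = V₀ - H * V₁ + W₁ * H)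
    (hV₁x : V₁x = -(K * V₀ - V₀ * K) + (Q * V₁ - V₁ * Q))
    (hW₁x : W₁x = -(K * W₀ - W₀ * K) + (Q₁ * W₁ - W₁ * Q₁))
    (hW₀x : W₀x = V₀x - (Hx * V₁ + H * V₁x) + (W₁x * H + W₁ * Hx))
    (hQ₁t : Q₁t = Qt + ((W₀ * H - H * V₀) * K - K * (W₀ * H - H * V₀))) :
    Q₁t - W₀x + (Q₁ * W₀ - W₀ * Q₁) = Qt - V₀x + (Q * V₀ - V₀ * Q) := by
  have e₁ : W₁ * H - H * V₁ = W₀ - V₀ := by rw [hW₀]; abel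
  have e₂ : H * K - K * H = Q₁ - Q := by rw [h₁]; abel
  have e₃ : Q₁ * (W₁ * H - H * V₁) = Q₁ * (W₀ - V₀) := by rw [e₁]
  have e₄ : (W₁ * H - H * V₁) * Q = (W₀ - V₀) * Q := by rw [e₁]
  have e₅ : W₀ * (H * K - K * H) = W₀ * (Q₁ - Q) := by rw [e₂]
  have e₆ : (H * K - K * H) * V₀ = (Q₁ - Q) * V₀ := by rw [e₂]
  rw [hQ₁t, hW₀x, hV₁x, hW₁x, hHx]
  rw [← sub_eq_zero] at e₃ e₄ e₅ e₆ ⊢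
  have := congrArg₂ (· + ·) (congrArg₂ (· - ·) e₅ e₆) (congrArg₂ (· - ·) e₄ e₃)
  simp only [sub_zero, add_zero] at this
  rw [← this]
  noncomm_ring

theorem zeroCurvature_V1 {K Q Qx Qxx : A} (hQ : K * Q = -(Q * K))
    (hQx : K * Qx = -(Qx * K)) (hQxx : K * Qxx = -(Qxx * K)) :
    -(2 * ((Qx * Q + Q * Qx + Qxx) * K))
      = -(K * (-Qxx + 2 * Q ^ 3 + Qx * Q - Q * Qx) - (-Qxx + 2 * Q ^ 3 + Qx * Q - Q * Qx) * K)
        + (Q * -(2 * ((Q ^ 2 + Qx) * K)) - -(2 * ((Q ^ 2 + Qx) * K)) * Q) := by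
  have move {X e : A} (h : K * X = e) (Y : A) : K * (X * Y) = e * Y := by
    rw [← mul_assoc, h]
  have hQ' := move hQ
  have hQx' := move hQx
  simp only [pow_succ, pow_zero, one_mul, two_mul, mul_assoc, mul_add, add_mul, mul_sub, sub_mul,
    neg_mul, mul_neg, hQ, hQx, hQxx, hQ', hQx', neg_neg, neg_add, neg_sub]
  abel

theorem curvature_eq {Q Qx Qxx Qxxx Qt : A} :
    Qt - (-Qxxx + 2 * (Qx * Q * Q + Q * Qx * Q + Q * Q * Qx) + (Qxx * Q + Qx * Qx)
        - (Qx * Qx + Q * Qxx))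
      + (Q * (-Qxx + 2 * Q ^ 3 + Qx * Q - Q * Qx) - (-Qxx + 2 * Q ^ 3 + Qx * Q - Q * Qx) * Q)
    = Qt + Qxxx - 3 * (Qx * Q * Q + Q * Q * Qx) := by
  noncomm_ring

variable [Algebra ℂ A]

theorem exists_even_odd {K : A} (hK : K * K = -1) (H : A) :
    ∃ D O : A, H = D + O ∧ K * D = D * K ∧ K * O = -(O * K) := by
  refine ⟨(1 / 2 : ℂ) • (H - K * H * K), (1 / 2 : ℂ) • (H + K * H * K), ?_, ?_, ?_⟩
  · module
  · simp only [mul_smul_comm, smul_mul_assoc, mul_sub, sub_mul, ← mul_assoc, hK]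
    simp only [mul_assoc, hK]
    congr 1; noncomm_ring
  · simp only [mul_smul_comm, smul_mul_assoc, mul_add, add_mul, ← mul_assoc, hK, ← smul_neg]
    simp only [mul_assoc, hK]
    congr 1; noncomm_ring

theorem dressed_V {K H Q Qx Qxx Q₁ Q₁x Q₁xx Hx Hxx : A} (hK : K * K = -1)
    (hQ : K * Q = -(Q * K)) (hQx : K * Qx = -(Qx * K))
    (h₁ : Q₁ = Q + (H * K - K * H)) (hHx : Hx = Q₁ * H - H * Q)
    (h₁x : Q₁x = Qx + (Hx * K - K * Hx))
    (hHxx : Hxx = Q₁x * H + Q₁ * Hx - (Hx * Q + H * Qx))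
    (h₁xx : Q₁xx = Qxx + (Hxx * K - K * Hxx)) :
    -(2 * ((Q₁ ^ 2 + Q₁x) * K))
      = -(2 * ((Q ^ 2 + Qx) * K)) - H * (4 * Q) + 4 * Q₁ * H ∧
    -Q₁xx + 2 * Q₁ ^ 3 + Q₁x * Q₁ - Q₁ * Q₁x
      = (-Qxx + 2 * Q ^ 3 + Qx * Q - Q * Qx) - H * (-(2 * ((Q ^ 2 + Qx) * K)))
        + -(2 * ((Q₁ ^ 2 + Q₁x) * K)) * H := by
  obtain ⟨D, O, rfl, hD, hO⟩ := exists_even_odd hK H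
  have move {X e : A} (h : K * X = e) (Y : A) : K * (X * Y) = e * Y := by
    rw [← mul_assoc, h]
  have e₁ : Q₁ = Q + 2 * (O * K) := by
    rw [h₁, mul_add, add_mul, hD, hO]; noncomm_ring
  have hQ₁ : K * Q₁ = -(Q₁ * K) := by
    simp only [e₁, two_mul, mul_add, add_mul, move hO, hQ, neg_mul, mul_assoc]; abel
  have e₁x : Q₁x = Qx + 2 * ((Q₁ * D - D * Q) * K) := by
    rw [h₁x, hHx]
    simp only [two_mul, mul_assoc, mul_add, add_mul, mul_sub, sub_mul, hD, hO, hQ, move hD,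
      move hO, move hQ₁, neg_mul, mul_neg, neg_neg]
    abel
  have hQ₁x : K * Q₁x = -(Q₁x * K) := by
    simp only [e₁x, two_mul, mul_add, add_mul, mul_sub, sub_mul, mul_assoc, move hD, move hQ₁,
      move hQ, hQx, neg_mul, mul_neg]; abel
  have e₁xx : Q₁xx = Qxx + 2 * ((Q₁x * D + Q₁ * (Q₁ * O - O * Q)
      - (Q₁ * O - O * Q) * Q - D * Qx) * K) := by
    rw [h₁xx, hHxx, hHx]
    simp only [two_mul, mul_assoc, mul_add, add_mul, mul_sub, sub_mul, hD, hO, hQ, hQx, move hD,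
      move hO, move hQ₁, move hQ₁x, move hQ, neg_mul, mul_neg, neg_neg]
    abel
  exact ⟨dressed_V1 hK hD hO hQ e₁ e₁x, dressed_V0 hK hD hO hQ hQx e₁ e₁x e₁xx⟩

/-- Derivative of `b + (a - b) P` for the projection `P` on a solution of a linear system whose
coefficient is a cubic polynomial in the spectral parameter. -/
theorem projection_flow {P H L₀ L₁ L₂ L₃ M₀ M₁ M₂ : A} {a b : ℂ} (hP : P * P = P)
    (hH : H = b • 1 + (a - b) • P) (hM₂ : M₂ = L₂ - H * L₃ + L₃ * H)
    (hM₁ : M₁ = L₁ - H * L₂ + M₂ * H) (hM₀ : M₀ = L₀ - H * L₁ + M₁ * H) :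
    (a - b) • ((1 - P) * (a ^ 3 • L₃ + a ^ 2 • L₂ + a • L₁ + L₀) * P
      - P * (b ^ 3 • L₃ + b ^ 2 • L₂ + b • L₁ + L₀) * (1 - P)) = M₀ * H - H * L₀ := by
  have hpow (k : ℕ) : H ^ k = a ^ k • P + b ^ k • (1 - P) := by
    induction k with
    | zero => simp
    | succ k ih =>
      rw [pow_succ, ih, hH]
      simp only [mul_add, add_mul, mul_smul_comm, smul_mul_assoc, sub_mul, one_mul, mul_one, hP,
        smul_sub, smul_add, sub_self]
      module
  have key (L : A) (k : ℕ) : (a - b) • (a ^ k • ((1 - P) * L * P) - b ^ k • (P * L * (1 - P)))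
      = (L * H - H * L) * H ^ k := by
    rw [hpow, hH]
    simp only [mul_add, add_mul, mul_sub, sub_mul, mul_smul_comm, smul_mul_assoc, one_mul, mul_one,
      mul_assoc, hP, smul_sub, smul_add]
    module
  have e₃ := key L₃ 3
  have e₂ := key L₂ 2
  have e₁ := key L₁ 1
  have e₀ := key L₀ 0
  have : M₀ * H - H * L₀ = (L₃ * H - H * L₃) * H ^ 3 + (L₂ * H - H * L₂) * H ^ 2
      + (L₁ * H - H * L₁) * H ^ 1 + (L₀ * H - H * L₀) * H ^ 0 := by
    rw [hM₀, hM₁, hM₂]; noncomm_ring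
  rw [this, ← e₃, ← e₂, ← e₁, ← e₀]
  simp only [mul_add, add_mul, mul_smul_comm, smul_mul_assoc]
  module

theorem intertwine {H L₀ L₁ L₂ L₃ M₀ M₁ M₂ : A} (ζ : ℂ) (hM₂ : M₂ = L₂ - H * L₃ + L₃ * H)
    (hM₁ : M₁ = L₁ - H * L₂ + M₂ * H) (hM₀ : M₀ = L₀ - H * L₁ + M₁ * H) :
    (ζ ^ 3 • L₃ + ζ ^ 2 • M₂ + ζ • M₁ + M₀) * (ζ • 1 - H)
      - (ζ • 1 - H) * (ζ ^ 3 • L₃ + ζ ^ 2 • L₂ + ζ • L₁ + L₀) = -(M₀ * H - H * L₀) := by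
  have e₂ : ζ ^ 3 • M₂ = ζ ^ 3 • (L₂ - H * L₃ + L₃ * H) := by rw [← hM₂]
  have e₁ : ζ ^ 2 • M₁ = ζ ^ 2 • (L₁ - H * L₂ + M₂ * H) := by rw [← hM₁]
  have e₀ : ζ • M₀ = ζ • (L₀ - H * L₁ + M₁ * H) := by rw [← hM₀]
  simp only [mul_add, add_mul, mul_sub, sub_mul, mul_smul_comm, smul_mul_assoc, one_mul, mul_one,
    smul_sub, smul_add, smul_smul, ← pow_succ, ← pow_succ'] at *
  simp only [Nat.reduceAdd] at *
  linear_combination (norm := module) e₂ + e₁ + e₀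

end Algebra

section MatrixCalculus

variable {l m n : Type*}

/-- Entrywise derivative of a curve of matrices. -/
def MatHasDerivAt (F : ℝ → Matrix l m ℂ) (F' : Matrix l m ℂ) (s : ℝ) : Prop :=
  ∀ i j, HasDerivAt (fun x => F x i j) (F' i j) s

namespace MatHasDerivAt

variable {F G : ℝ → Matrix l m ℂ} {F' G' : Matrix l m ℂ} {s : ℝ}

theorem unique (h : MatHasDerivAt F F' s) (h' : MatHasDerivAt F G' s) : F' = G' := by
  ext i j
  exact (h i j).unique (h' i j)

theorem const (C : Matrix l m ℂ) (s : ℝ) : MatHasDerivAt (fun _ => C) 0 s := fun _ _ =>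
  hasDerivAt_const _ _

theorem add (hF : MatHasDerivAt F F' s) (hG : MatHasDerivAt G G' s) :
    MatHasDerivAt (fun x => F x + G x) (F' + G') s := fun i j => (hF i j).add (hG i j)

theorem neg (hF : MatHasDerivAt F F' s) : MatHasDerivAt (fun x => -F x) (-F') s := fun i j =>
  (hF i j).neg

theorem sub (hF : MatHasDerivAt F F' s) (hG : MatHasDerivAt G G' s) :
    MatHasDerivAt (fun x => F x - G x) (F' - G') s := fun i j => (hF i j).sub (hG i j)

theorem smul (c : ℂ) (hF : MatHasDerivAt F F' s) :
    MatHasDerivAt (fun x => c • F x) (c • F') s := fun i j => (hF i j).const_mul c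

theorem mul [Fintype m] {G : ℝ → Matrix m n ℂ} {G' : Matrix m n ℂ}
    (hF : MatHasDerivAt F F' s) (hG : MatHasDerivAt G G' s) :
    MatHasDerivAt (fun x => F x * G x) (F' * G s + F s * G') s := fun i j => by
  simp only [Matrix.mul_apply, Matrix.add_apply, ← Finset.sum_add_distrib]
  exact HasDerivAt.fun_sum fun k _ => (hF i k).mul (hG k j)

theorem const_mul [Fintype l] [Fintype m] (C : Matrix n l ℂ) (hF : MatHasDerivAt F F' s) :
    MatHasDerivAt (fun x => C * F x) (C * F') s := by
  simpa using (const C s).mul hF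

theorem mul_const [Fintype m] (C : Matrix m n ℂ) (hF : MatHasDerivAt F F' s) :
    MatHasDerivAt (fun x => F x * C) (F' * C) s := by
  simpa using hF.mul (const C s)

theorem congr (hF : MatHasDerivAt F F' s) (hG : ∀ x, G x = F x) (h : G' = F') :
    MatHasDerivAt G G' s := by
  rw [show G = F from funext hG, h]
  exact hF

theorem mulVec [Fintype m] {ψ : ℝ → m → ℂ} {ψ' : m → ℂ} [Fintype l]
    (hF : MatHasDerivAt F F' s) (hψ : HasDerivAt ψ ψ' s) :
    HasDerivAt (fun x => F x *ᵥ ψ x) (F' *ᵥ ψ s + F s *ᵥ ψ') s := by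
  rw [hasDerivAt_pi] at hψ ⊢
  intro i
  simp only [Matrix.mulVec, dotProduct, Pi.add_apply, ← Finset.sum_add_distrib]
  exact HasDerivAt.fun_sum fun k _ => (hF i k).mul (hψ k)

end MatHasDerivAt

end MatrixCalculus

section Projection

open scoped ComplexOrder in
theorem star_dotProduct_self_ne_zero {ψ : Fin 4 → ℂ} (h : ψ ≠ 0) : star ψ ⬝ᵥ ψ ≠ 0 := by
  rwa [Ne, dotProduct_star_self_eq_zero]

theorem projOf_mul_self {ψ : Fin 4 → ℂ} (h : ψ ≠ 0) : projOf ψ * projOf ψ = projOf ψ := by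
  have := star_dotProduct_self_ne_zero h
  simp only [projOf, smul_mul_assoc, mul_smul_comm, vecMulVec_mul_vecMulVec, smul_smul]
  ext i j
  simp [vecMulVec_apply]
  field_simp

theorem projOf_mulVec_self {ψ : Fin 4 → ℂ} (h : ψ ≠ 0) : projOf ψ *ᵥ ψ = ψ := by
  have := star_dotProduct_self_ne_zero h
  ext i
  simp [projOf, smul_mulVec, vecMulVec_mulVec]
  field_simp

theorem conjTranspose_projOf (ψ : Fin 4 → ℂ) : (projOf ψ)ᴴ = projOf ψ := by
  have : star (star ψ ⬝ᵥ ψ) = star ψ ⬝ᵥ ψ := (star_dotProduct _ _).symm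
  ext i j
  simp only [projOf, conjTranspose_apply, Matrix.smul_apply, smul_eq_mul, star_mul', star_inv₀,
    this, vecMulVec_apply, Pi.star_apply, star_star]
  ring

theorem MatHasDerivAt.projOf {ψ : ℝ → Fin 4 → ℂ} {L : Matrix (Fin 4) (Fin 4) ℂ} {s : ℝ}
    (hψ : HasDerivAt ψ (L *ᵥ ψ s) s) (h : ψ s ≠ 0) :
    MatHasDerivAt (fun x => projOf (ψ x))
      ((1 - _root_.projOf (ψ s)) * L * _root_.projOf (ψ s)
        + _root_.projOf (ψ s) * Lᴴ * (1 - _root_.projOf (ψ s))) s := by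
  have hn := star_dotProduct_self_ne_zero h
  have hstar : HasDerivAt (fun x => star (ψ x)) (star (L *ᵥ ψ s)) s := hψ.star
  have hdot : HasDerivAt (fun x => star (ψ x) ⬝ᵥ ψ x)
      (star (L *ᵥ ψ s) ⬝ᵥ ψ s + star (ψ s) ⬝ᵥ (L *ᵥ ψ s)) s := by
    simp only [dotProduct, ← Finset.sum_add_distrib]
    exact HasDerivAt.fun_sum fun k _ => (hasDerivAt_pi.1 hstar k).mul (hasDerivAt_pi.1 hψ k)
  have hL : star (ψ s) ᵥ* Lᴴ = star (L *ᵥ ψ s) := (star_mulVec _ _).symm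
  intro i j
  refine ((hdot.inv hn).mul ((hasDerivAt_pi.1 hψ i).mul (hasDerivAt_pi.1 hstar j))).congr_deriv ?_
  simp only [_root_.projOf, sub_mul, mul_sub, one_mul, mul_one, smul_mul_assoc, mul_smul_comm,
    mul_vecMulVec, vecMulVec_mul, hL, Matrix.sub_apply, Matrix.add_apply, Matrix.smul_apply,
    vecMulVec_apply, smul_eq_mul, vecMulVec_mulVec, Pi.smul_apply, op_smul_eq_smul, Pi.mul_apply,
    Pi.inv_apply, ← dotProduct_mulVec]
  field_simp
  ring

end Projection

section LaxMatrices

/-- `K = iJ`. -/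
def Kmat : Matrix (Fin 4) (Fin 4) ℂ := Complex.I • Jmat

/-- The potential matrix as a field on `ℝ²`. -/
def Qfield (u v w : ℝ × ℝ → ℂ) (p : ℝ × ℝ) : Matrix (Fin 4) (Fin 4) ℂ := Qmat (u p) (v p) (w p)

theorem Jmat_mul_self : Jmat * Jmat = 1 := by
  rw [Jmat, diagonal_mul_diagonal, ← diagonal_one]
  congr 1
  ext i
  fin_cases i <;> simp

theorem Kmat_mul_self : Kmat * Kmat = -1 := by
  simp [Kmat, Jmat_mul_self, smul_smul]

theorem Kmat_mul_Qmat (u v w : ℂ) : Kmat * Qmat u v w = -(Qmat u v w * Kmat) := by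
  rw [Kmat, smul_mul_assoc, mul_smul_comm, ← smul_neg]
  congr 1
  ext i j
  rw [Matrix.neg_apply, Jmat, diagonal_mul, mul_diagonal]
  fin_cases i <;> fin_cases j <;> simp [Qmat]

theorem conjTranspose_Kmat : Kmatᴴ = -Kmat := by
  have : Jmatᴴ = Jmat := by
    rw [Jmat, diagonal_conjTranspose]
    congr 1
    ext i
    fin_cases i <;> simp
  simp [Kmat, conjTranspose_smul, this]

theorem conjTranspose_Qmat (u v w : ℂ) : (Qmat u v w)ᴴ = -Qmat u v w := by
  ext i j
  fin_cases i <;> fin_cases j <;> simp [Qmat]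

theorem Umat_eq (ζ u v w : ℂ) :
    Umat ζ u v w = ζ ^ 3 • 0 + ζ ^ 2 • 0 + ζ • -Kmat + Qmat u v w := by
  simp only [Umat, Kmat]
  module

/-- Coefficient of `ζ` in `V(ζ)`. -/
def V₁mat (u v w ux vx wx : ℂ) : Matrix (Fin 4) (Fin 4) ℂ :=
  -(2 * ((Qmat u v w ^ 2 + Qmat ux vx wx) * Kmat))

/-- Constant coefficient of `V(ζ)`. -/
def V₀mat (u v w ux vx wx uxx vxx wxx : ℂ) : Matrix (Fin 4) (Fin 4) ℂ :=
  -Qmat uxx vxx wxx + 2 * Qmat u v w ^ 3 + Qmat ux vx wx * Qmat u v w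
    - Qmat u v w * Qmat ux vx wx

theorem Vmat_eq (ζ u v w ux vx wx uxx vxx wxx : ℂ) :
    Vmat ζ u v w ux vx wx uxx vxx wxx = ζ ^ 3 • -(4 * Kmat) + ζ ^ 2 • (4 * Qmat u v w)
      + ζ • V₁mat u v w ux vx wx + V₀mat u v w ux vx wx uxx vxx wxx := by
  have h4 (X : Matrix (Fin 4) (Fin 4) ℂ) : 4 * X = (4 : ℂ) • X := by
    rw [Algebra.smul_def, map_ofNat]
  have h2 (X : Matrix (Fin 4) (Fin 4) ℂ) : 2 * X = (2 : ℂ) • X := by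
    rw [two_mul, two_smul]
  simp only [Vmat, Kmat, V₁mat, V₀mat, h4, h2, mul_smul_comm]
  module

theorem conjTranspose_Umat (ζ u v w : ℂ) :
    (Umat ζ u v w)ᴴ = -Umat ((starRingEnd ℂ) ζ) u v w := by
  simp only [Umat_eq, conjTranspose_add, conjTranspose_smul, conjTranspose_Qmat, conjTranspose_neg,
    conjTranspose_Kmat, smul_zero, conjTranspose_zero]
  simp only [starRingEnd_apply]
  module

theorem conjTranspose_Vmat (ζ u v w ux vx wx uxx vxx wxx : ℂ) :
    (Vmat ζ u v w ux vx wx uxx vxx wxx)ᴴ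
      = -Vmat ((starRingEnd ℂ) ζ) u v w ux vx wx uxx vxx wxx := by
  have h₁ : (V₁mat u v w ux vx wx)ᴴ = -V₁mat u v w ux vx wx := by
    have : Kmat * (Qmat u v w * Qmat u v w) = Qmat u v w * Qmat u v w * Kmat := by
      rw [← mul_assoc, Kmat_mul_Qmat, neg_mul, mul_assoc, Kmat_mul_Qmat, mul_neg, neg_neg,
        mul_assoc]
    simp only [V₁mat, two_mul, pow_two, conjTranspose_neg, conjTranspose_add, conjTranspose_mul,
      conjTranspose_Qmat, conjTranspose_Kmat, mul_add, add_mul, neg_mul, this,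
      mul_neg, Kmat_mul_Qmat]
    abel
  have h₀ : (V₀mat u v w ux vx wx uxx vxx wxx)ᴴ = -V₀mat u v w ux vx wx uxx vxx wxx := by
    simp only [V₀mat, two_mul, pow_succ, pow_zero, one_mul, conjTranspose_neg, conjTranspose_add,
      conjTranspose_sub, conjTranspose_mul, conjTranspose_Qmat, neg_mul, mul_neg, mul_assoc]
    abel
  have h4 (X : Matrix (Fin 4) (Fin 4) ℂ) : 4 * X = (4 : ℂ) • X := by
    rw [Algebra.smul_def, map_ofNat]
  simp only [Vmat_eq, conjTranspose_add, conjTranspose_smul, conjTranspose_neg, h₁, h₀, h4,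
    conjTranspose_Kmat, conjTranspose_Qmat]
  simp only [starRingEnd_apply, star_pow, star_ofNat]
  module

theorem MatHasDerivAt.qmat {f g h : ℝ → ℂ} {f' g' h' : ℂ} {s : ℝ} (hf : HasDerivAt f f' s)
    (hg : HasDerivAt g g' s) (hh : HasDerivAt h h' s) :
    MatHasDerivAt (fun x => Qmat (f x) (g x) (h x)) (Qmat f' g' h') s := by
  intro i j
  fin_cases i <;> fin_cases j <;>
    first
    | exact hasDerivAt_const _ _
    | exact hf
    | exact hg
    | exact hh
    | exact hf.star.neg
    | exact hg.star.neg
    | exact hh.star.neg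

theorem Qmat_mul_mul (a b c a' b' c' a'' b'' c'' : ℂ) :
    Qmat a b c * Qmat a' b' c' * Qmat a'' b'' c''
      = !![0, -((a * star a' + b * star b' + c * star c') * a''),
            -((a * star a' + b * star b' + c * star c') * b''),
            -((a * star a' + b * star b' + c * star c') * c'');
          star a * (a' * star a'' + b' * star b'' + c' * star c''), 0, 0, 0;
          star b * (a' * star a'' + b' * star b'' + c' * star c''), 0, 0, 0;
          star c * (a' * star a'' + b' * star b'' + c' * star c''), 0, 0, 0] := by
  have h : Qmat a b c * Qmat a' b' c'
      = !![-(a * star a' + b * star b' + c * star c'), 0, 0, 0;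
          0, -(star a * a'), -(star a * b'), -(star a * c');
          0, -(star b * a'), -(star b * b'), -(star b * c');
          0, -(star c * a'), -(star c * b'), -(star c * c')] := by
    ext i j
    rw [Matrix.mul_apply, Fin.sum_univ_four]
    fin_cases i <;> fin_cases j <;> simp [Qmat] <;> ring
  rw [h]
  ext i j
  rw [Matrix.mul_apply, Fin.sum_univ_four]
  fin_cases i <;> fin_cases j <;> (simp [Qmat]; try ring)

/-- The left-hand side of the vcmKdV equation in matrix form. -/
theorem Qmat_vcmLHS (u v w : ℝ × ℝ → ℂ) (p : ℝ × ℝ) :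
    Qmat (vcmLHS u v w u p) (vcmLHS u v w v p) (vcmLHS u v w w p)
      = Qmat (dT u p) (dT v p) (dT w p)
        + Qmat (dX (dX (dX u)) p) (dX (dX (dX v)) p) (dX (dX (dX w)) p)
        - 3 * (Qmat (dX u p) (dX v p) (dX w p) * Qmat (u p) (v p) (w p) * Qmat (u p) (v p) (w p)
          + Qmat (u p) (v p) (w p) * Qmat (u p) (v p) (w p)
            * Qmat (dX u p) (dX v p) (dX w p)) := by
  have h3 (X : Matrix (Fin 4) (Fin 4) ℂ) : 3 * X = (3 : ℂ) • X := by
    rw [Algebra.smul_def, map_ofNat]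
  have hc : (starRingEnd ℂ) 3 = 3 := map_ofNat _ 3
  rw [h3, Qmat_mul_mul, Qmat_mul_mul]
  ext i j
  fin_cases i <;> fin_cases j <;> simp [vcmLHS, Qmat, hc] <;> ring

theorem Qmat_eq_zero_iff {a b c : ℂ} : Qmat a b c = 0 ↔ a = 0 ∧ b = 0 ∧ c = 0 := by
  constructor
  · intro h
    exact ⟨by simpa [Qmat] using congrFun₂ h 0 1, by simpa [Qmat] using congrFun₂ h 0 2,
      by simpa [Qmat] using congrFun₂ h 0 3⟩
  · rintro ⟨rfl, rfl, rfl⟩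
    ext i j
    fin_cases i <;> fin_cases j <;> simp [Qmat]

end LaxMatrices

section OneFold

open scoped ContDiff

/-- Smooth in `x` for every `t`, differentiable in `t` for every `x`. -/
structure SliceSmooth (f : ℝ × ℝ → ℂ) : Prop where
  contDiff_x : ∀ t, ContDiff ℝ ∞ fun x => f (x, t)
  differentiable_t : ∀ x, Differentiable ℝ fun t => f (x, t)

theorem ContDiff.sliceSmooth {f : ℝ × ℝ → ℂ} (hf : ContDiff ℝ ∞ f) : SliceSmooth f where
  contDiff_x t := hf.comp (contDiff_id.prodMk contDiff_const)
  differentiable_t x :=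
    (hf.comp (contDiff_const.prodMk contDiff_id)).differentiable (by simp)

theorem contDiff_x_dX {f : ℝ × ℝ → ℂ} (hf : ∀ t, ContDiff ℝ ∞ fun x => f (x, t)) (t : ℝ) :
    ContDiff ℝ ∞ fun x => dX f (x, t) :=
  (contDiff_infty_iff_deriv.1 (hf t)).2

theorem hasDerivAt_dX {f : ℝ × ℝ → ℂ} (hf : ∀ t, ContDiff ℝ ∞ fun x => f (x, t)) (p : ℝ × ℝ) :
    HasDerivAt (fun x => f (x, p.2)) (dX f p) p.1 :=
  ((hf p.2).differentiable (by simp) p.1).hasDerivAt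

theorem SliceSmooth.hasDerivAt_dT {f : ℝ × ℝ → ℂ} (hf : SliceSmooth f) (p : ℝ × ℝ) :
    HasDerivAt (fun t => f (p.1, t)) (dT f p) p.2 :=
  (hf.differentiable_t p.1 p.2).hasDerivAt

theorem ContDiff.starRingEnd {f : ℝ → ℂ} {n : ℕ∞ω} (hf : ContDiff ℝ n f) :
    ContDiff ℝ n fun x => (starRingEnd ℂ) (f x) :=
  Complex.conjCLE.contDiff.comp hf

variable {u v w : ℝ × ℝ → ℂ} {ζ : ℂ} {ψ : ℝ × ℝ → Fin 4 → ℂ}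

theorem contDiff_Umat (ζ : ℂ) {f g h : ℝ → ℂ} {n : ℕ∞ω} (hf : ContDiff ℝ n f)
    (hg : ContDiff ℝ n g) (hh : ContDiff ℝ n h) (i j : Fin 4) :
    ContDiff ℝ n fun x => Umat ζ (f x) (g x) (h x) i j := by
  simp only [Umat, Matrix.add_apply]
  refine contDiff_const.add ?_
  fin_cases i <;> fin_cases j <;>
    first
    | exact contDiff_const
    | exact hf
    | exact hg
    | exact hh
    | exact hf.starRingEnd.neg
    | exact hg.starRingEnd.neg
    | exact hh.starRingEnd.neg

/-- Solutions of the Lax pair are smooth in `x`. -/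
theorem SolvesLax.contDiff_x (hu : SliceSmooth u) (hv : SliceSmooth v) (hw : SliceSmooth w)
    (hψ : SolvesLax u v w ζ ψ) (t : ℝ) : ContDiff ℝ ∞ fun x => ψ (x, t) := by
  rw [contDiff_infty]
  intro n
  induction n with
  | zero =>
    exact contDiff_zero.2 <| continuous_iff_continuousAt.2 fun x => (hψ (x, t)).1.continuousAt
  | succ n ih =>
    have hd (x : ℝ) := (hψ (x, t)).1
    rw [Nat.cast_succ, contDiff_succ_iff_deriv]
    refine ⟨fun x => (hd x).differentiableAt, by simp, ?_⟩
    rw [show deriv (fun x => ψ (x, t)) = fun x => (Ufield u v w ζ (x, t)).mulVec (ψ (x, t)) from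
      funext fun x => (hd x).deriv, contDiff_pi]
    intro i
    have hU := contDiff_Umat (n := (n : ℕ∞ω)) ζ ((hu.contDiff_x t).of_le (mod_cast le_top))
      ((hv.contDiff_x t).of_le (mod_cast le_top)) ((hw.contDiff_x t).of_le (mod_cast le_top)) i
    exact ContDiff.sum (s := Finset.univ) fun j _ => (hU j).mul (contDiff_pi.1 ih j)

theorem SliceSmooth.u1of {f : ℝ × ℝ → ℂ} (hf : SliceSmooth f)
    (hu : SliceSmooth u) (hv : SliceSmooth v) (hw : SliceSmooth w)
    (hψ : SolvesLax u v w ζ ψ) (h0 : ∀ p, ψ p ≠ 0) (j : Fin 4) :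
    SliceSmooth (u1of f ζ ψ j) where
  contDiff_x t := by
    have h := contDiff_pi.1 (hψ.contDiff_x hu hv hw t)
    have hn : ContDiff ℝ ∞ fun x => star (ψ (x, t)) ⬝ᵥ ψ (x, t) :=
      ContDiff.sum fun k _ => (h k).starRingEnd.mul (h k)
    simp only [_root_.u1of, div_eq_mul_inv]
    exact (hf.contDiff_x t).sub (((contDiff_const.mul (h 0)).mul (h j).starRingEnd).mul
      (hn.inv fun x => star_dotProduct_self_ne_zero (h0 _)))
  differentiable_t x := by
    have h (k : Fin 4) : Differentiable ℝ fun t => ψ (x, t) k := fun t =>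
      (hasDerivAt_pi.1 (hψ (x, t)).2 k).differentiableAt
    have hc (k : Fin 4) : Differentiable ℝ fun t => (starRingEnd ℂ) (ψ (x, t) k) := fun t =>
      (hasDerivAt_pi.1 (hψ (x, t)).2 k).star.differentiableAt
    have hn : Differentiable ℝ fun t => star (ψ (x, t)) ⬝ᵥ ψ (x, t) :=
      Differentiable.fun_sum fun k _ => (hc k).mul (h k)
    exact (hf.differentiable_t x).sub
      ((((differentiable_const _).mul (h 0)).mul (hc j)).div hn
        fun t => star_dotProduct_self_ne_zero (h0 _))

/-- The matrix `H` with `T(ζ') = (ζ' - ζ*)⁻¹ (ζ' - H)`. -/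
def Hmat (ζ : ℂ) (ψ : Fin 4 → ℂ) : Matrix (Fin 4) (Fin 4) ℂ :=
  (starRingEnd ℂ) ζ • 1 + (ζ - (starRingEnd ℂ) ζ) • projOf ψ

theorem Tone_eq {ζ' : ℂ} (h : ζ' ≠ (starRingEnd ℂ) ζ) (ψ : Fin 4 → ℂ) :
    Tone ζ ζ' ψ = (ζ' - (starRingEnd ℂ) ζ)⁻¹ • (ζ' • 1 - Hmat ζ ψ) := by
  have := sub_ne_zero.2 h
  rw [eq_inv_smul_iff₀ this, Tone, Hmat, smul_sub, smul_smul, mul_div_cancel₀ _ this]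
  module

theorem Qfield_u1of (u v w : ℝ × ℝ → ℂ) (ζ : ℂ) (ψ : ℝ × ℝ → Fin 4 → ℂ) (p : ℝ × ℝ) :
    Qfield (u1of u ζ ψ 1) (u1of v ζ ψ 2) (u1of w ζ ψ 3) p
      = Qfield u v w p + (Hmat ζ (ψ p) * Kmat - Kmat * Hmat ζ (ψ p)) := by
  have hn : (starRingEnd ℂ) (star (ψ p) ⬝ᵥ ψ p) = star (ψ p) ⬝ᵥ ψ p :=
    (star_dotProduct _ _).symm
  have hc : (starRingEnd ℂ) 2 = 2 := map_ofNat _ 2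
  have hH : Hmat ζ (ψ p) * Kmat - Kmat * Hmat ζ (ψ p)
      = (Complex.I * (ζ - (starRingEnd ℂ) ζ)) •
        (projOf (ψ p) * Jmat - Jmat * projOf (ψ p)) := by
    simp only [Hmat, Kmat, add_mul, mul_add, smul_mul_assoc, mul_smul_comm, one_mul, mul_one]
    module
  rw [hH, Qfield, Qfield]
  ext i j
  rw [Matrix.add_apply, Matrix.smul_apply, Matrix.sub_apply, Jmat, diagonal_mul, mul_diagonal,
    projOf, Matrix.smul_apply, vecMulVec_apply]
  fin_cases i <;> fin_cases j <;> simp [Qmat, u1of, hn, hc] <;> ring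

end OneFold

section Dressing

open scoped ContDiff

/-- Coefficient of `ζ` in `V(ζ)`, as a field on `ℝ²`. -/
def V₁field (u v w : ℝ × ℝ → ℂ) (p : ℝ × ℝ) : Matrix (Fin 4) (Fin 4) ℂ :=
  V₁mat (u p) (v p) (w p) (dX u p) (dX v p) (dX w p)

/-- Constant coefficient of `V(ζ)`, as a field on `ℝ²`. -/
def V₀field (u v w : ℝ × ℝ → ℂ) (p : ℝ × ℝ) : Matrix (Fin 4) (Fin 4) ℂ :=
  V₀mat (u p) (v p) (w p) (dX u p) (dX v p) (dX w p)
    (dX (dX u) p) (dX (dX v) p) (dX (dX w) p)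

/-- Smooth potentials together with a nowhere-vanishing solution of their Lax pair at `ζ`. -/
structure DarbouxSeed (u v w : ℝ × ℝ → ℂ) (ζ : ℂ) (ψ : ℝ × ℝ → Fin 4 → ℂ) : Prop where
  hu : SliceSmooth u
  hv : SliceSmooth v
  hw : SliceSmooth w
  lax : SolvesLax u v w ζ ψ
  ne_zero : ∀ p, ψ p ≠ 0

variable {u v w : ℝ × ℝ → ℂ} {ζ : ℂ} {ψ : ℝ × ℝ → Fin 4 → ℂ}

theorem hasDerivAt_Qfield_x (hu : ∀ t, ContDiff ℝ ∞ fun x => u (x, t))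
    (hv : ∀ t, ContDiff ℝ ∞ fun x => v (x, t)) (hw : ∀ t, ContDiff ℝ ∞ fun x => w (x, t))
    (p : ℝ × ℝ) :
    MatHasDerivAt (fun x => Qfield u v w (x, p.2)) (Qfield (dX u) (dX v) (dX w) p) p.1 :=
  MatHasDerivAt.qmat (hasDerivAt_dX hu p) (hasDerivAt_dX hv p) (hasDerivAt_dX hw p)

theorem hasDerivAt_V₁field (hu : SliceSmooth u) (hv : SliceSmooth v) (hw : SliceSmooth w)
    (p : ℝ × ℝ) :
    MatHasDerivAt (fun x => V₁field u v w (x, p.2))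
      (-(2 * ((Qfield (dX u) (dX v) (dX w) p * Qfield u v w p
        + Qfield u v w p * Qfield (dX u) (dX v) (dX w) p
        + Qfield (dX (dX u)) (dX (dX v)) (dX (dX w)) p) * Kmat))) p.1 := by
  have h := hasDerivAt_Qfield_x hu.contDiff_x hv.contDiff_x hw.contDiff_x p
  have h' := hasDerivAt_Qfield_x (contDiff_x_dX hu.contDiff_x) (contDiff_x_dX hv.contDiff_x)
    (contDiff_x_dX hw.contDiff_x) p
  refine (((h.mul h).add h').mul_const Kmat |>.const_mul 2).neg.congr (fun x => ?_) rfl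
  rw [← pow_two]
  rfl

theorem hasDerivAt_V₀field (hu : SliceSmooth u) (hv : SliceSmooth v) (hw : SliceSmooth w)
    (p : ℝ × ℝ) :
    MatHasDerivAt (fun x => V₀field u v w (x, p.2))
      (-Qfield (dX (dX (dX u))) (dX (dX (dX v))) (dX (dX (dX w))) p
        + 2 * (Qfield (dX u) (dX v) (dX w) p * Qfield u v w p * Qfield u v w p
          + Qfield u v w p * Qfield (dX u) (dX v) (dX w) p * Qfield u v w p
          + Qfield u v w p * Qfield u v w p * Qfield (dX u) (dX v) (dX w) p)
        + (Qfield (dX (dX u)) (dX (dX v)) (dX (dX w)) p * Qfield u v w p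
          + Qfield (dX u) (dX v) (dX w) p * Qfield (dX u) (dX v) (dX w) p)
        - (Qfield (dX u) (dX v) (dX w) p * Qfield (dX u) (dX v) (dX w) p
          + Qfield u v w p * Qfield (dX (dX u)) (dX (dX v)) (dX (dX w)) p)) p.1 := by
  have h := hasDerivAt_Qfield_x hu.contDiff_x hv.contDiff_x hw.contDiff_x p
  have hu' := contDiff_x_dX hu.contDiff_x
  have hv' := contDiff_x_dX hv.contDiff_x
  have hw' := contDiff_x_dX hw.contDiff_x
  have h' := hasDerivAt_Qfield_x hu' hv' hw' p
  have h'' := hasDerivAt_Qfield_x (contDiff_x_dX hu') (contDiff_x_dX hv') (contDiff_x_dX hw') p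
  refine (((h''.neg.add (((h.mul h).mul h).const_mul 2)).add (h'.mul h)).sub (h.mul h')).congr
    (fun x => ?_) ?_
  · rw [← pow_two, ← pow_succ]
    rfl
  · simp only [add_mul]

namespace DarbouxSeed

theorem sliceSmooth_u (d : DarbouxSeed u v w ζ ψ) (j : Fin 4) : SliceSmooth (u1of u ζ ψ j) :=
  d.hu.u1of d.hu d.hv d.hw d.lax d.ne_zero j

theorem sliceSmooth_v (d : DarbouxSeed u v w ζ ψ) (j : Fin 4) : SliceSmooth (u1of v ζ ψ j) :=
  d.hv.u1of d.hu d.hv d.hw d.lax d.ne_zero j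

theorem sliceSmooth_w (d : DarbouxSeed u v w ζ ψ) (j : Fin 4) : SliceSmooth (u1of w ζ ψ j) :=
  d.hw.u1of d.hu d.hv d.hw d.lax d.ne_zero j

theorem hasDerivAt_Hmat {φ : ℝ → Fin 4 → ℂ} {L : Matrix (Fin 4) (Fin 4) ℂ} {s : ℝ}
    (hφ : HasDerivAt φ (L *ᵥ φ s) s) (h : φ s ≠ 0) :
    MatHasDerivAt (fun x => Hmat ζ (φ x))
      ((ζ - (starRingEnd ℂ) ζ) • ((1 - projOf (φ s)) * L * projOf (φ s)
        + projOf (φ s) * Lᴴ * (1 - projOf (φ s)))) s :=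
  ((MatHasDerivAt.const ((starRingEnd ℂ) ζ • 1) s).add
    ((MatHasDerivAt.projOf hφ h).smul (ζ - (starRingEnd ℂ) ζ))).congr (fun _ => rfl)
    (zero_add _).symm

theorem hasDerivAt_Hmat_x (d : DarbouxSeed u v w ζ ψ) (p : ℝ × ℝ) :
    MatHasDerivAt (fun x => Hmat ζ (ψ (x, p.2)))
      (Qfield (u1of u ζ ψ 1) (u1of v ζ ψ 2) (u1of w ζ ψ 3) p * Hmat ζ (ψ p)
        - Hmat ζ (ψ p) * Qfield u v w p) p.1 := by
  refine (hasDerivAt_Hmat (ζ := ζ) (d.lax p).1 (d.ne_zero p)).congr (fun _ => rfl) ?_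
  rw [Ufield, conjTranspose_Umat, mul_neg, neg_mul, ← sub_eq_add_neg, Umat_eq, Umat_eq]
  symm
  refine projection_flow (M₂ := 0) (M₁ := -Kmat) (projOf_mul_self (d.ne_zero p)) rfl ?_ ?_ ?_
  · simp
  · simp
  · rw [Qfield_u1of, Qfield]
    noncomm_ring

theorem Qfield_dX (d : DarbouxSeed u v w ζ ψ) (p : ℝ × ℝ) :
    Qfield (dX (u1of u ζ ψ 1)) (dX (u1of v ζ ψ 2)) (dX (u1of w ζ ψ 3)) p
      = Qfield (dX u) (dX v) (dX w) p
        + ((Qfield (u1of u ζ ψ 1) (u1of v ζ ψ 2) (u1of w ζ ψ 3) p * Hmat ζ (ψ p)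
            - Hmat ζ (ψ p) * Qfield u v w p) * Kmat
          - Kmat * (Qfield (u1of u ζ ψ 1) (u1of v ζ ψ 2) (u1of w ζ ψ 3) p * Hmat ζ (ψ p)
            - Hmat ζ (ψ p) * Qfield u v w p)) := by
  refine (hasDerivAt_Qfield_x (d.sliceSmooth_u 1).contDiff_x (d.sliceSmooth_v 2).contDiff_x
    (d.sliceSmooth_w 3).contDiff_x p).unique ?_
  have hH := d.hasDerivAt_Hmat_x p
  exact ((hasDerivAt_Qfield_x d.hu.contDiff_x d.hv.contDiff_x d.hw.contDiff_x p).add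
    ((hH.mul_const Kmat).sub (hH.const_mul Kmat))).congr (fun x => Qfield_u1of ..) rfl

theorem V_relations (d : DarbouxSeed u v w ζ ψ) (p : ℝ × ℝ) :
    V₁field (u1of u ζ ψ 1) (u1of v ζ ψ 2) (u1of w ζ ψ 3) p
      = V₁field u v w p - Hmat ζ (ψ p) * (4 * Qfield u v w p)
        + 4 * Qfield (u1of u ζ ψ 1) (u1of v ζ ψ 2) (u1of w ζ ψ 3) p * Hmat ζ (ψ p) ∧
    V₀field (u1of u ζ ψ 1) (u1of v ζ ψ 2) (u1of w ζ ψ 3) p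
      = V₀field u v w p - Hmat ζ (ψ p) * V₁field u v w p
        + V₁field (u1of u ζ ψ 1) (u1of v ζ ψ 2) (u1of w ζ ψ 3) p * Hmat ζ (ψ p) := by
  have hu := (d.sliceSmooth_u 1).contDiff_x
  have hv := (d.sliceSmooth_v 2).contDiff_x
  have hw := (d.sliceSmooth_w 3).contDiff_x
  have hH := d.hasDerivAt_Hmat_x p
  have hQ := hasDerivAt_Qfield_x d.hu.contDiff_x d.hv.contDiff_x d.hw.contDiff_x p
  have hHx := ((hasDerivAt_Qfield_x hu hv hw p).mul hH).sub (hH.mul hQ)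
  have hxx := (hasDerivAt_Qfield_x (contDiff_x_dX d.hu.contDiff_x)
    (contDiff_x_dX d.hv.contDiff_x) (contDiff_x_dX d.hw.contDiff_x) p).add
    ((hHx.mul_const Kmat).sub (hHx.const_mul Kmat))
  exact dressed_V Kmat_mul_self (Kmat_mul_Qmat _ _ _) (Kmat_mul_Qmat _ _ _)
    (Qfield_u1of u v w ζ ψ p) rfl (d.Qfield_dX p) rfl
    ((hasDerivAt_Qfield_x (contDiff_x_dX hu) (contDiff_x_dX hv) (contDiff_x_dX hw) p).unique
      (hxx.congr (fun x => d.Qfield_dX (x, p.2)) rfl))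

theorem four_mul_Qfield_u1of (u v w : ℝ × ℝ → ℂ) (ζ : ℂ) (ψ : ℝ × ℝ → Fin 4 → ℂ) (p : ℝ × ℝ) :
    4 * Qfield (u1of u ζ ψ 1) (u1of v ζ ψ 2) (u1of w ζ ψ 3) p
      = 4 * Qfield u v w p - Hmat ζ (ψ p) * -(4 * Kmat) + -(4 * Kmat) * Hmat ζ (ψ p) := by
  rw [Qfield_u1of]
  noncomm_ring

theorem hasDerivAt_Hmat_t (d : DarbouxSeed u v w ζ ψ) (p : ℝ × ℝ) :
    MatHasDerivAt (fun t => Hmat ζ (ψ (p.1, t)))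
      (V₀field (u1of u ζ ψ 1) (u1of v ζ ψ 2) (u1of w ζ ψ 3) p * Hmat ζ (ψ p)
        - Hmat ζ (ψ p) * V₀field u v w p) p.2 := by
  refine (hasDerivAt_Hmat (ζ := ζ) (d.lax p).2 (d.ne_zero p)).congr (fun _ => rfl) ?_
  rw [Vfield, conjTranspose_Vmat, mul_neg, neg_mul, ← sub_eq_add_neg, Vmat_eq, Vmat_eq]
  exact (projection_flow (projOf_mul_self (d.ne_zero p)) rfl
    (four_mul_Qfield_u1of u v w ζ ψ p) (d.V_relations p).1 (d.V_relations p).2).symm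

theorem Qmat_vcmLHS_u1of (d : DarbouxSeed u v w ζ ψ) (p : ℝ × ℝ) :
    Qmat (vcmLHS (u1of u ζ ψ 1) (u1of v ζ ψ 2) (u1of w ζ ψ 3) (u1of u ζ ψ 1) p)
      (vcmLHS (u1of u ζ ψ 1) (u1of v ζ ψ 2) (u1of w ζ ψ 3) (u1of v ζ ψ 2) p)
      (vcmLHS (u1of u ζ ψ 1) (u1of v ζ ψ 2) (u1of w ζ ψ 3) (u1of w ζ ψ 3) p)
      = Qmat (vcmLHS u v w u p) (vcmLHS u v w v p) (vcmLHS u v w w p) := by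
  have hu := d.sliceSmooth_u 1
  have hv := d.sliceSmooth_v 2
  have hw := d.sliceSmooth_w 3
  have hHx := d.hasDerivAt_Hmat_x p
  have hHt := d.hasDerivAt_Hmat_t p
  have hV₁ := hasDerivAt_V₁field d.hu d.hv d.hw p
  have hV₀ := hasDerivAt_V₀field d.hu d.hv d.hw p
  have hW₁ := hasDerivAt_V₁field hu hv hw p
  have hW₀ := hasDerivAt_V₀field hu hv hw p
  have hW₀x := hW₀.unique (((hV₀.sub (hHx.mul hV₁)).add (hW₁.mul hHx)).congr
    (fun x => (d.V_relations (x, p.2)).2) rfl)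
  have hQt := (MatHasDerivAt.qmat (hu.hasDerivAt_dT p) (hv.hasDerivAt_dT p)
    (hw.hasDerivAt_dT p)).unique
    (((MatHasDerivAt.qmat (d.hu.hasDerivAt_dT p) (d.hv.hasDerivAt_dT p)
      (d.hw.hasDerivAt_dT p)).add ((hHt.mul_const Kmat).sub (hHt.const_mul Kmat))).congr
      (fun t => Qfield_u1of u v w ζ ψ (p.1, t)) rfl)
  have h := dressed_curvature (Qfield_u1of u v w ζ ψ p) rfl (d.V_relations p).2
    (zeroCurvature_V1 (Kmat_mul_Qmat _ _ _) (Kmat_mul_Qmat _ _ _) (Kmat_mul_Qmat _ _ _))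
    (zeroCurvature_V1 (Kmat_mul_Qmat _ _ _) (Kmat_mul_Qmat _ _ _) (Kmat_mul_Qmat _ _ _))
    hW₀x hQt
  rw [Qmat_vcmLHS, Qmat_vcmLHS]
  exact curvature_eq.symm.trans (h.trans curvature_eq)

theorem vcmKdVeq_u1of (d : DarbouxSeed u v w ζ ψ) (h : vcmKdVeq u v w) :
    vcmKdVeq (u1of u ζ ψ 1) (u1of v ζ ψ 2) (u1of w ζ ψ 3) := fun p =>
  Qmat_eq_zero_iff.1 ((d.Qmat_vcmLHS_u1of p).trans (Qmat_eq_zero_iff.2 (h p)))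

theorem hasDerivAt_Tone_x (d : DarbouxSeed u v w ζ ψ) {ζ' : ℂ} (h : ζ' ≠ (starRingEnd ℂ) ζ)
    (p : ℝ × ℝ) :
    MatHasDerivAt (fun x => Tone ζ ζ' (ψ (x, p.2)))
      (Ufield (u1of u ζ ψ 1) (u1of v ζ ψ 2) (u1of w ζ ψ 3) ζ' p * Tone ζ ζ' (ψ p)
        - Tone ζ ζ' (ψ p) * Ufield u v w ζ' p) p.1 := by
  refine (((MatHasDerivAt.const (ζ' • 1) _).sub (d.hasDerivAt_Hmat_x p)).smul
    (ζ' - (starRingEnd ℂ) ζ)⁻¹).congr (fun x => Tone_eq h _) ?_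
  rw [Tone_eq h, Ufield, Ufield, Umat_eq, Umat_eq, mul_smul_comm, smul_mul_assoc, ← smul_sub]
  congr 1
  rw [zero_sub]
  refine intertwine ζ' (M₂ := 0) (M₁ := -Kmat) ?_ ?_ ?_
  · simp
  · simp
  · exact (Qfield_u1of u v w ζ ψ p).trans (by rw [Qfield]; noncomm_ring)

theorem hasDerivAt_Tone_t (d : DarbouxSeed u v w ζ ψ) {ζ' : ℂ} (h : ζ' ≠ (starRingEnd ℂ) ζ)
    (p : ℝ × ℝ) :
    MatHasDerivAt (fun t => Tone ζ ζ' (ψ (p.1, t)))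
      (Vfield (u1of u ζ ψ 1) (u1of v ζ ψ 2) (u1of w ζ ψ 3) ζ' p * Tone ζ ζ' (ψ p)
        - Tone ζ ζ' (ψ p) * Vfield u v w ζ' p) p.2 := by
  refine (((MatHasDerivAt.const (ζ' • 1) _).sub (d.hasDerivAt_Hmat_t p)).smul
    (ζ' - (starRingEnd ℂ) ζ)⁻¹).congr (fun x => Tone_eq h _) ?_
  rw [Tone_eq h, Vfield, Vfield, Vmat_eq, Vmat_eq, mul_smul_comm, smul_mul_assoc, ← smul_sub]
  congr 1
  rw [zero_sub]
  exact intertwine ζ' (four_mul_Qfield_u1of u v w ζ ψ p) (d.V_relations p).1 (d.V_relations p).2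

theorem solvesLax_Tone (d : DarbouxSeed u v w ζ ψ) {ζ' : ℂ} (h : ζ' ≠ (starRingEnd ℂ) ζ)
    {χ : ℝ × ℝ → Fin 4 → ℂ} (hχ : SolvesLax u v w ζ' χ) :
    SolvesLax (u1of u ζ ψ 1) (u1of v ζ ψ 2) (u1of w ζ ψ 3) ζ'
      fun p => Tone ζ ζ' (ψ p) *ᵥ χ p := fun p => by
  constructor
  · refine ((d.hasDerivAt_Tone_x h p).mulVec (hχ p).1).congr_deriv ?_
    rw [sub_mulVec, mulVec_mulVec, mulVec_mulVec, sub_add_cancel]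
  · refine ((d.hasDerivAt_Tone_t h p).mulVec (hχ p).2).congr_deriv ?_
    rw [sub_mulVec, mulVec_mulVec, mulVec_mulVec, sub_add_cancel]

end DarbouxSeed

end Dressing

section Bordered

variable {N : ℕ}

theorem bordered_eq_submatrix (M : Matrix (Fin N) (Fin N) ℂ) (c r : Fin N → ℂ) :
    bordered M c r = (fromBlocks M (replicateCol (Fin 1) c) (replicateRow (Fin 1) r) 0).submatrix
      finSumFinEquiv.symm finSumFinEquiv.symm := by
  ext i j
  refine Fin.lastCases ?_ (fun i => ?_) i <;> refine Fin.lastCases ?_ (fun j => ?_) j <;>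
    simp [bordered, finSumFinEquiv_symm_apply_castSucc]

theorem det_bordered_vecMul (M : Matrix (Fin N) (Fin N) ℂ) (c y : Fin N → ℂ) :
    (bordered M c (y ᵥ* M)).det = -(M.det * (y ⬝ᵥ c)) := by
  have h : fromBlocks M (replicateCol (Fin 1) c) (replicateRow (Fin 1) (y ᵥ* M)) 0
      = fromBlocks 1 0 (replicateRow (Fin 1) y) 1
        * fromBlocks M (replicateCol (Fin 1) c) 0
          (-(replicateRow (Fin 1) y * replicateCol (Fin 1) c)) := by
    rw [fromBlocks_multiply]
    simp [replicateRow_vecMul]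
  rw [bordered_eq_submatrix, det_submatrix_equiv_self, h, det_mul, det_fromBlocks_zero₁₂,
    det_fromBlocks_zero₂₁]
  simp [mul_apply, dotProduct]

end Bordered

section PartialFractions

theorem conjTranspose_Tone_mul {ζ₁ ζ : ℂ} {ψ : Fin 4 → ℂ} (hψ : ψ ≠ 0) (h : ζ ≠ ζ₁)
    (h' : ζ ≠ (starRingEnd ℂ) ζ₁) : (Tone ζ₁ ((starRingEnd ℂ) ζ) ψ)ᴴ * Tone ζ₁ ζ ψ = 1 := by
  have h₁ := sub_ne_zero.2 h
  have h₂ := sub_ne_zero.2 h'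
  have hc : star ((ζ₁ - (starRingEnd ℂ) ζ₁) / ((starRingEnd ℂ) ζ - (starRingEnd ℂ) ζ₁))
      = ((starRingEnd ℂ) ζ₁ - ζ₁) / (ζ - ζ₁) := by
    rw [← starRingEnd_apply]
    simp
  rw [Tone, Tone, conjTranspose_sub, conjTranspose_one, conjTranspose_smul, conjTranspose_projOf,
    hc]
  simp only [sub_mul, mul_sub, one_mul, mul_one, smul_mul_smul_comm, projOf_mul_self hψ]
  match_scalars <;> field_simp
  ring

variable {ζs : ℕ → ℂ} {Ψs : ℕ → ℝ × ℝ → Fin 4 → ℂ} {p : ℝ × ℝ} {k : ℕ}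

theorem PsiIter_succ (ζs : ℕ → ℂ) (Ψs : ℕ → ℝ × ℝ → Fin 4 → ℂ) (k i : ℕ) (p : ℝ × ℝ) :
    PsiIter ζs Ψs (k + 1) i p
      = Tone (ζs k) (ζs i) (PsiIter ζs Ψs k k p) *ᵥ PsiIter ζs Ψs k i p := rfl

theorem PsiIter_eq_TNmat_mulVec (ζs : ℕ → ℂ) (Ψs : ℕ → ℝ × ℝ → Fin 4 → ℂ) (k i : ℕ) (p : ℝ × ℝ) :
    PsiIter ζs Ψs k i p = TNmat ζs Ψs k (ζs i) p *ᵥ Ψs i p := by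
  induction k with
  | zero => simp [PsiIter, TNmat]
  | succ k ih => rw [PsiIter_succ, TNmat, ← mulVec_mulVec, ← ih]

theorem conjTranspose_TNmat_mul {ζ : ℂ} (h0 : ∀ l < k, PsiIter ζs Ψs l l p ≠ 0)
    (h : ∀ l < k, ζ ≠ ζs l) (h' : ∀ l < k, ζ ≠ (starRingEnd ℂ) (ζs l)) :
    (TNmat ζs Ψs k ((starRingEnd ℂ) ζ) p)ᴴ * TNmat ζs Ψs k ζ p = 1 := by
  induction k with
  | zero => simp [TNmat]
  | succ k ih =>
    rw [TNmat, TNmat, conjTranspose_mul, mul_assoc, ← mul_assoc (Tone _ _ _)ᴴ,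
      conjTranspose_Tone_mul (h0 k k.lt_succ_self) (h k k.lt_succ_self) (h' k k.lt_succ_self),
      one_mul]
    exact ih (fun l hl => h0 l (hl.trans k.lt_succ_self))
      (fun l hl => h l (hl.trans k.lt_succ_self))
      fun l hl => h' l (hl.trans k.lt_succ_self)

theorem projOf_mul_TNmat_conj (h0 : ∀ l < k, PsiIter ζs Ψs l l p ≠ 0)
    (h : ∀ l < k, ζs k ≠ ζs l) (h' : ∀ l < k, ζs k ≠ (starRingEnd ℂ) (ζs l)) :
    projOf (PsiIter ζs Ψs k k p) * TNmat ζs Ψs k ((starRingEnd ℂ) (ζs k)) p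
      = vecMulVec ((star (PsiIter ζs Ψs k k p) ⬝ᵥ PsiIter ζs Ψs k k p)⁻¹ • PsiIter ζs Ψs k k p)
        (star (Ψs k p)) := by
  have hφ : star (PsiIter ζs Ψs k k p) ᵥ* TNmat ζs Ψs k ((starRingEnd ℂ) (ζs k)) p
      = star (Ψs k p) := by
    rw [← conjTranspose_conjTranspose (TNmat ζs Ψs k _ p), ← star_mulVec,
      PsiIter_eq_TNmat_mulVec, mulVec_mulVec, conjTranspose_TNmat_mul h0 h h', one_mulVec]
  rw [projOf, smul_mul_assoc, vecMulVec_mul, hφ, smul_vecMulVec]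

theorem exists_TNmat_eq_sub_sum (h0 : ∀ l < k, PsiIter ζs Ψs l l p ≠ 0)
    (hdist : ∀ i < k, ∀ j < k, i ≠ j → ζs i ≠ ζs j)
    (hnc : ∀ i < k, ∀ j < k, ζs i ≠ (starRingEnd ℂ) (ζs j)) :
    ∃ y : ℕ → Fin 4 → ℂ,
      (∀ ζ, (∀ j < k, ζ ≠ (starRingEnd ℂ) (ζs j)) → TNmat ζs Ψs k ζ p
        = 1 - ∑ j ∈ Finset.range k,
          (ζ - (starRingEnd ℂ) (ζs j))⁻¹ • vecMulVec (y j) (star (Ψs j p))) ∧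
      ∑ j ∈ Finset.range k, vecMulVec (y j) (star (Ψs j p))
        = ∑ l ∈ Finset.range k, (ζs l - (starRingEnd ℂ) (ζs l)) • projOf (PsiIter ζs Ψs l l p) := by
  induction k with
  | zero => exact ⟨0, by simp [TNmat], by simp⟩
  | succ k ih =>
    have hlt {l : ℕ} (hl : l < k) : l < k + 1 := hl.trans k.lt_succ_self
    obtain ⟨y, hT, hS⟩ := ih (fun l hl => h0 l (hlt hl))
      (fun i hi j hj => hdist i (hlt hi) j (hlt hj)) fun i hi j hj => hnc i (hlt hi) j (hlt hj)
    set P := projOf (PsiIter ζs Ψs k k p) with hP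
    set b := (starRingEnd ℂ) (ζs k) with hb
    have hbj (j : ℕ) (hj : j < k) : b ≠ (starRingEnd ℂ) (ζs j) := fun h =>
      hdist k k.lt_succ_self j (hlt hj) hj.ne' ((starRingEnd ℂ).injective h)
    have hPT := projOf_mul_TNmat_conj (ζs := ζs) (Ψs := Ψs) (p := p)
      (fun l hl => h0 l (hlt hl)) (fun l hl => hdist k k.lt_succ_self l (hlt hl) hl.ne')
      fun l hl => hnc k k.lt_succ_self l (hlt hl)
    rw [← hP, ← hb, hT b hbj, mul_sub, mul_one, Finset.mul_sum, sub_eq_iff_eq_add] at hPT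
    set s := ζs k - b with hs
    let y' : ℕ → Fin 4 → ℂ := fun j =>
      if j = k then (s) • (star (PsiIter ζs Ψs k k p) ⬝ᵥ PsiIter ζs Ψs k k p)⁻¹ •
        PsiIter ζs Ψs k k p
      else y j + ((s) * (b - (starRingEnd ℂ) (ζs j))⁻¹) • P *ᵥ y j
    have hy' (j : ℕ) (hj : j < k) : vecMulVec (y' j) (star (Ψs j p))
        = vecMulVec (y j) (star (Ψs j p)) + ((s) * (b - (starRingEnd ℂ) (ζs j))⁻¹) •
          (P * vecMulVec (y j) (star (Ψs j p))) := by
      simp only [y', if_neg hj.ne, add_vecMulVec, smul_vecMulVec, mul_vecMulVec]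
    have hk : vecMulVec (y' k) (star (Ψs k p)) = (s) • (P - ∑ j ∈ Finset.range k,
        P * (b - (starRingEnd ℂ) (ζs j))⁻¹ • vecMulVec (y j) (star (Ψs j p))) := by
      simp only [y', if_true]
      rw [smul_vecMulVec, sub_eq_iff_eq_add.2 hPT]
    refine ⟨y', fun ζ hζ => ?_, ?_⟩
    · have hζb := sub_ne_zero.2 (hζ k k.lt_succ_self)
      rw [TNmat, hT ζ fun j hj => hζ j (hlt hj), Tone, ← hP, ← hb, ← hs, Finset.sum_range_succ, hk,
        sub_mul, one_mul, smul_mul_assoc, mul_sub, mul_one, Finset.mul_sum]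
      simp only [smul_sub, Finset.smul_sum, mul_smul_comm, smul_smul]
      have hsum : ∑ j ∈ Finset.range k,
          (ζ - (starRingEnd ℂ) (ζs j))⁻¹ • vecMulVec (y' j) (star (Ψs j p))
          = ∑ j ∈ Finset.range k, (ζ - (starRingEnd ℂ) (ζs j))⁻¹ • vecMulVec (y j) (star (Ψs j p))
            + (∑ j ∈ Finset.range k, ((ζ - b)⁻¹ * ((s) * (b - (starRingEnd ℂ) (ζs j))⁻¹)) •
                (P * vecMulVec (y j) (star (Ψs j p)))
              - ∑ j ∈ Finset.range k, ((s) / (ζ - b) * (ζ - (starRingEnd ℂ) (ζs j))⁻¹) •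
                (P * vecMulVec (y j) (star (Ψs j p)))) := by
        rw [← Finset.sum_sub_distrib, ← Finset.sum_add_distrib]
        refine Finset.sum_congr rfl fun j hj => ?_
        have hj := Finset.mem_range.1 hj
        have h₁ := sub_ne_zero.2 (hζ j (hlt hj))
        have h₂ := sub_ne_zero.2 (hbj j hj)
        rw [hy' j hj, smul_add, smul_smul, ← sub_smul]
        congr 2
        rw [← hb] at hζb
        field_simp
        ring
      rw [hsum, div_eq_inv_mul]
      simp only [← mul_assoc]
      abel
    · rw [Finset.sum_range_succ, Finset.sum_range_succ, ← hS, ← hb, ← hs, hk,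
        Finset.sum_congr rfl fun j hj => hy' j (Finset.mem_range.1 hj), Finset.sum_add_distrib,
        smul_sub, Finset.smul_sum]
      simp only [mul_smul_comm, smul_smul]
      abel

theorem TNmat_mulVec_eq_zero (h0 : ∀ l < k, PsiIter ζs Ψs l l p ≠ 0)
    (hnc : ∀ i < k, ζs i ≠ (starRingEnd ℂ) (ζs i)) {i : ℕ} (hi : i < k) :
    TNmat ζs Ψs k (ζs i) p *ᵥ Ψs i p = 0 := by
  rw [← PsiIter_eq_TNmat_mulVec]
  induction k with
  | zero => exact absurd hi i.not_lt_zero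
  | succ k ih =>
    rw [PsiIter_succ]
    rcases Nat.lt_succ_iff_lt_or_eq.1 hi with h | rfl
    · rw [ih (fun l hl => h0 l (hl.trans k.lt_succ_self))
        (fun l hl => hnc l (hl.trans k.lt_succ_self)) h, mulVec_zero]
    · rw [Tone, div_self (sub_ne_zero.2 (hnc i hi)), one_smul, sub_mulVec, one_mulVec,
        projOf_mulVec_self (h0 i hi), sub_self]

theorem det_bordered_MmatOf (h0 : ∀ l < k, PsiIter ζs Ψs l l p ≠ 0)
    (hdist : ∀ i < k, ∀ j < k, i ≠ j → ζs i ≠ ζs j)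
    (hnc : ∀ i < k, ∀ j < k, ζs i ≠ (starRingEnd ℂ) (ζs j)) (a b : Fin 4) :
    (bordered (MmatOf (fun j : Fin k => ζs j) (fun j : Fin k => Ψs j) p)
      (fun j => (starRingEnd ℂ) (Ψs j p b)) (fun j => Ψs j p a)).det
      = -((MmatOf (fun j : Fin k => ζs j) (fun j : Fin k => Ψs j) p).det
        * (∑ l ∈ Finset.range k,
          (ζs l - (starRingEnd ℂ) (ζs l)) • projOf (PsiIter ζs Ψs l l p)) a b) := by
  obtain ⟨y, hT, hS⟩ := exists_TNmat_eq_sub_sum h0 hdist hnc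
  have hr : (fun j : Fin k => Ψs j p a)
      = (fun j : Fin k => y j a) ᵥ* MmatOf (fun j : Fin k => ζs j) (fun j : Fin k => Ψs j) p := by
    ext i
    have h := TNmat_mulVec_eq_zero h0 (fun i hi => hnc i hi i hi) i.2
    rw [hT _ (hnc i i.2), sub_mulVec, one_mulVec, sub_eq_zero, sum_mulVec,
      ← Fin.sum_univ_eq_sum_range
      fun j => ((ζs i - (starRingEnd ℂ) (ζs j))⁻¹ • vecMulVec (y j) (star (Ψs j p))) *ᵥ Ψs i p] at h
    rw [h, Finset.sum_apply, vecMul, dotProduct]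
    refine Finset.sum_congr rfl fun j _ => ?_
    rw [smul_mulVec, vecMulVec_mulVec]
    simp [MmatOf]
    ring
  rw [hr, det_bordered_vecMul, ← hS, ← Fin.sum_univ_eq_sum_range
    fun j => vecMulVec (y j) (star (Ψs j p)), Matrix.sum_apply]
  simp [dotProduct, vecMulVec_apply]

end PartialFractions

section NFold

/-- The potential obtained from `f` after `k` Darboux steps, updated through the component `j`. -/
def potIter (ζs : ℕ → ℂ) (Ψs : ℕ → ℝ × ℝ → Fin 4 → ℂ) (f : ℝ × ℝ → ℂ) (j : Fin 4) :
    ℕ → ℝ × ℝ → ℂ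
  | 0 => f
  | k + 1 => u1of (potIter ζs Ψs f j k) (ζs k) (PsiIter ζs Ψs k k) j

variable {ζs : ℕ → ℂ} {Ψs : ℕ → ℝ × ℝ → Fin 4 → ℂ} {u v w : ℝ × ℝ → ℂ} {N k : ℕ}

theorem potIter_apply (ζs : ℕ → ℂ) (Ψs : ℕ → ℝ × ℝ → Fin 4 → ℂ) (f : ℝ × ℝ → ℂ) (j : Fin 4)
    (k : ℕ) (p : ℝ × ℝ) : potIter ζs Ψs f j k p = f p - 2 * Complex.I *
      (∑ l ∈ Finset.range k,
        (ζs l - (starRingEnd ℂ) (ζs l)) • projOf (PsiIter ζs Ψs l l p)) 0 j := by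
  induction k with
  | zero => simp [potIter]
  | succ k ih =>
    rw [potIter, u1of, ih, Finset.sum_range_succ, Matrix.add_apply, Matrix.smul_apply, projOf,
      Matrix.smul_apply, vecMulVec_apply]
    simp only [smul_eq_mul, Pi.star_apply, starRingEnd_apply]
    ring

/-- Smooth potentials with simultaneous Lax solutions `Ψs i`, `i < N`, to which the Darboux
recursion applies `N` times. -/
structure DarbouxChain (N : ℕ) (ζs : ℕ → ℂ) (Ψs : ℕ → ℝ × ℝ → Fin 4 → ℂ)
    (u v w : ℝ × ℝ → ℂ) : Prop where
  hu : SliceSmooth u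
  hv : SliceSmooth v
  hw : SliceSmooth w
  lax : ∀ i < N, SolvesLax u v w (ζs i) (Ψs i)
  ne_conj : ∀ i < N, ∀ j < N, ζs i ≠ (starRingEnd ℂ) (ζs j)
  ne_zero : ∀ l < N, ∀ p, PsiIter ζs Ψs l l p ≠ 0

namespace DarbouxChain

theorem solvesLax (c : DarbouxChain N ζs Ψs u v w) (hk : k ≤ N) :
    SliceSmooth (potIter ζs Ψs u 1 k) ∧ SliceSmooth (potIter ζs Ψs v 2 k) ∧
      SliceSmooth (potIter ζs Ψs w 3 k) ∧ ∀ i < N, SolvesLax (potIter ζs Ψs u 1 k)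
        (potIter ζs Ψs v 2 k) (potIter ζs Ψs w 3 k) (ζs i) (PsiIter ζs Ψs k i) := by
  induction k with
  | zero => exact ⟨c.hu, c.hv, c.hw, c.lax⟩
  | succ k ih =>
    obtain ⟨hu, hv, hw, hl⟩ := ih (Nat.le_of_succ_le hk)
    have d : DarbouxSeed _ _ _ _ _ := ⟨hu, hv, hw, hl k hk, c.ne_zero k hk⟩
    exact ⟨d.sliceSmooth_u 1, d.sliceSmooth_v 2, d.sliceSmooth_w 3,
      fun i hi => d.solvesLax_Tone (c.ne_conj i hi k hk) (hl i hi)⟩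

theorem darbouxSeed (c : DarbouxChain N ζs Ψs u v w) (hk : k < N) :
    DarbouxSeed (potIter ζs Ψs u 1 k) (potIter ζs Ψs v 2 k) (potIter ζs Ψs w 3 k) (ζs k)
      (PsiIter ζs Ψs k k) :=
  have ⟨hu, hv, hw, hl⟩ := c.solvesLax hk.le
  ⟨hu, hv, hw, hl k hk, c.ne_zero k hk⟩

theorem vcmKdVeq_potIter (c : DarbouxChain N ζs Ψs u v w) (h : vcmKdVeq u v w) (hk : k ≤ N) :
    vcmKdVeq (potIter ζs Ψs u 1 k) (potIter ζs Ψs v 2 k) (potIter ζs Ψs w 3 k) := by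
  induction k with
  | zero => exact h
  | succ k ih => exact (c.darbouxSeed hk).vcmKdVeq_u1of (ih (Nat.le_of_succ_le hk))

theorem hasDerivAt_TNmat (c : DarbouxChain N ζs Ψs u v w) (hk : k ≤ N) {ζ : ℂ}
    (hζ : ∀ i < k, ζ ≠ (starRingEnd ℂ) (ζs i)) (p : ℝ × ℝ) :
    MatHasDerivAt (fun x => TNmat ζs Ψs k ζ (x, p.2))
      (Ufield (potIter ζs Ψs u 1 k) (potIter ζs Ψs v 2 k) (potIter ζs Ψs w 3 k) ζ p
        * TNmat ζs Ψs k ζ p - TNmat ζs Ψs k ζ p * Ufield u v w ζ p) p.1 ∧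
    MatHasDerivAt (fun t => TNmat ζs Ψs k ζ (p.1, t))
      (Vfield (potIter ζs Ψs u 1 k) (potIter ζs Ψs v 2 k) (potIter ζs Ψs w 3 k) ζ p
        * TNmat ζs Ψs k ζ p - TNmat ζs Ψs k ζ p * Vfield u v w ζ p) p.2 := by
  induction k with
  | zero =>
    exact ⟨(MatHasDerivAt.const 1 p.1).congr (fun _ => rfl) (by simp [TNmat, potIter]),
      (MatHasDerivAt.const 1 p.2).congr (fun _ => rfl) (by simp [TNmat, potIter])⟩
  | succ k ih =>
    obtain ⟨hx, ht⟩ := ih (Nat.le_of_succ_le hk) fun i hi => hζ i (hi.trans k.lt_succ_self)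
    have d := c.darbouxSeed hk
    have h := hζ k k.lt_succ_self
    constructor
    · refine ((d.hasDerivAt_Tone_x h p).mul hx).congr (fun _ => rfl) ?_
      simp only [TNmat, potIter]
      noncomm_ring
    · refine ((d.hasDerivAt_Tone_t h p).mul ht).congr (fun _ => rfl) ?_
      simp only [TNmat, potIter]
      noncomm_ring

end DarbouxChain

end NFold

/-- the transformed potentials of the `N`-fold Darboux
transformation satisfy the intertwining identities, and in particular form a
solution of the vcmKdV equation. -/
theorem N_fold_transformed_potentials (N : ℕ) (ζs : ℕ → ℂ) (Ψs : ℕ → ℝ × ℝ → Fin 4 → ℂ)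
    (u v w : ℝ × ℝ → ℂ)
    (hu : ContDiff ℝ (⊤ : ℕ∞) u) (hv : ContDiff ℝ (⊤ : ℕ∞) v)
    (hw : ContDiff ℝ (⊤ : ℕ∞) w) (hsol : vcmKdVeq u v w)
    (hdist : ∀ i j, i < N → j < N → i ≠ j → ζs i ≠ ζs j)
    (hnc : ∀ i j, i < N → j < N → ζs i ≠ (starRingEnd ℂ) (ζs j))
    (hlax : ∀ i, i < N → SolvesLax u v w (ζs i) (Ψs i))
    (hnz : ∀ i, i < N → ∀ p : ℝ × ℝ, Ψs i p ≠ 0)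
    (hiter : ∀ k, k < N → ∀ p : ℝ × ℝ, PsiIter ζs Ψs k k p ≠ 0)
    (hM : ∀ p : ℝ × ℝ,
      IsUnit (MmatOf (fun j : Fin N => ζs j.val) (fun j : Fin N => Ψs j.val) p))
    (uN vN wN : ℝ × ℝ → ℂ)
    (huN : uN = fun p => u p + 2 * Complex.I
      * (bordered (MmatOf (fun j : Fin N => ζs j.val) (fun j : Fin N => Ψs j.val) p)
          (fun j => (starRingEnd ℂ) (Ψs j.val p 1)) (fun j => Ψs j.val p 0)).det
      / (MmatOf (fun j : Fin N => ζs j.val) (fun j : Fin N => Ψs j.val) p).det)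
    (hvN : vN = fun p => v p + 2 * Complex.I
      * (bordered (MmatOf (fun j : Fin N => ζs j.val) (fun j : Fin N => Ψs j.val) p)
          (fun j => (starRingEnd ℂ) (Ψs j.val p 2)) (fun j => Ψs j.val p 0)).det
      / (MmatOf (fun j : Fin N => ζs j.val) (fun j : Fin N => Ψs j.val) p).det)
    (hwN : wN = fun p => w p + 2 * Complex.I
      * (bordered (MmatOf (fun j : Fin N => ζs j.val) (fun j : Fin N => Ψs j.val) p)
          (fun j => (starRingEnd ℂ) (Ψs j.val p 3)) (fun j => Ψs j.val p 0)).det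
      / (MmatOf (fun j : Fin N => ζs j.val) (fun j : Fin N => Ψs j.val) p).det) :
    (∀ ζ : ℂ, (∀ i : Fin N, ζ ≠ (starRingEnd ℂ) (ζs i.val)) → ∀ p : ℝ × ℝ,
      dXM (fun q => TNmat ζs Ψs N ζ q) p + TNmat ζs Ψs N ζ p * Ufield u v w ζ p
        = Ufield uN vN wN ζ p * TNmat ζs Ψs N ζ p ∧
      dTM (fun q => TNmat ζs Ψs N ζ q) p + TNmat ζs Ψs N ζ p * Vfield u v w ζ p
        = Vfield uN vN wN ζ p * TNmat ζs Ψs N ζ p) ∧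
    vcmKdVeq uN vN wN := by
  have c : DarbouxChain N ζs Ψs u v w := ⟨hu.sliceSmooth, hv.sliceSmooth, hw.sliceSmooth, hlax,
    fun i hi j hj => hnc i j hi hj, hiter⟩
  have hpot (f : ℝ × ℝ → ℂ) (j : Fin 4) : (fun p => f p + 2 * Complex.I
      * (bordered (MmatOf (fun j : Fin N => ζs j.val) (fun j : Fin N => Ψs j.val) p)
          (fun i => (starRingEnd ℂ) (Ψs i.val p j)) (fun j => Ψs j.val p 0)).det
      / (MmatOf (fun j : Fin N => ζs j.val) (fun j : Fin N => Ψs j.val) p).det)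
      = potIter ζs Ψs f j N := by
    ext p
    have hdet := ((isUnit_iff_isUnit_det _).1 (hM p)).ne_zero
    rw [det_bordered_MmatOf (fun l hl => hiter l hl p) (fun i hi j hj => hdist i j hi hj)
      (fun i hi j hj => hnc i j hi hj), potIter_apply]
    field_simp
    ring
  rw [huN, hvN, hwN, hpot, hpot, hpot]
  refine ⟨fun ζ hζ p => ?_, c.vcmKdVeq_potIter hsol le_rfl⟩
  obtain ⟨hx, ht⟩ := c.hasDerivAt_TNmat le_rfl (fun i hi => hζ ⟨i, hi⟩) p
  have hx' : dXM (fun q => TNmat ζs Ψs N ζ q) p = _ := Matrix.ext fun i j => (hx i j).deriv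
  have ht' : dTM (fun q => TNmat ζs Ψs N ζ q) p = _ := Matrix.ext fun i j => (ht i j).deriv
  exact ⟨by rw [hx', sub_add_cancel], by rw [ht', sub_add_cancel]⟩

end
end

section
/- (N-bright-bright-bright soliton solutions from the zero seed.) Let ζ₁, …, ζ_N ∈ ℂ be pairwise distinct with ζ_i ≠ ζ_j* for all i, j, let c₁, c₂, c₃ be real constants not all zero, and let Ψ_j(x,t) = (e^{−iζ_j(4tζ_j² + x)}, c₁e^{iζ_j(4tζ_j² + x)}, c₂e^{iζ_j(4tζ_j² + x)}, c₃e^{iζ_j(4tζ_j² + x)})ᵀ. Let M be the N×N matrix with entries M_{jk} = Ψ_j†Ψ_k/(ζ_k − ζ_j*) and assume det M ≠ 0 at every (x, t). Writing Ψ_i = (φ_i, ϕ_i, ψ_i, χ_i)ᵀ and letting M₁ (resp. M₂, M₃) be M bordered on the right by the column (ϕ₁*, …, ϕ_N*)ᵀ (resp. (ψ₁*, …, ψ_N*)ᵀ, (χ₁*, …, χ_N*)ᵀ) and at the bottom by the row (φ₁, …, φ_N, 0), the functions u_N = 2i det(M₁)/det(M), v_N = 2i det(M₂)/det(M), w_N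 = 2i det(M₃)/det(M) form a smooth solution of the vcmKdV equation. -/
open Matrix Filter Topology

noncomputable section

/-- A matrix-valued curve `F` has entrywise derivative `F'` at `y`. -/
def HasEntryDerivAt {m n : Type*} (F : ℝ → Matrix m n ℂ) (F' : Matrix m n ℂ) (y : ℝ) : Prop :=
  ∀ i j, HasDerivAt (fun z => F z i j) (F' i j) y

namespace HasEntryDerivAt

variable {l m n : Type*} {y : ℝ}

theorem const (A : Matrix m n ℂ) : HasEntryDerivAt (fun _ => A) 0 y :=
  fun _ _ => hasDerivAt_const _ _

theorem mul [Fintype m] {F : ℝ → Matrix l m ℂ} {F' : Matrix l m ℂ} {H : ℝ → Matrix m n ℂ}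
    {H' : Matrix m n ℂ} (hF : HasEntryDerivAt F F' y) (hH : HasEntryDerivAt H H' y) :
    HasEntryDerivAt (fun z => F z * H z) (F' * H y + F y * H') y := by
  intro i j
  simp only [Matrix.add_apply, Matrix.mul_apply, ← Finset.sum_add_distrib]
  exact HasDerivAt.fun_sum fun k _ => (hF i k).mul (hH k j)

theorem conjTranspose {F : ℝ → Matrix m n ℂ} {F' : Matrix m n ℂ} (hF : HasEntryDerivAt F F' y) :
    HasEntryDerivAt (fun z => (F z)ᴴ) F'ᴴ y :=
  fun i j => (hF j i).star

theorem unique {F : ℝ → Matrix m n ℂ} {F' F'' : Matrix m n ℂ} (h : HasEntryDerivAt F F' y)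
    (h' : HasEntryDerivAt F F'' y) : F' = F'' :=
  Matrix.ext fun i j => (h i j).unique (h' i j)

theorem congr_deriv {F : ℝ → Matrix m n ℂ} {F' F'' : Matrix m n ℂ} (h : HasEntryDerivAt F F' y)
    (h' : F' = F'') : HasEntryDerivAt F F'' y :=
  h' ▸ h

variable [Fintype n] [DecidableEq n]

theorem differentiableAt_det {F : ℝ → Matrix n n ℂ}
    (hF : ∀ i j, DifferentiableAt ℝ (fun z => F z i j) y) :
    DifferentiableAt ℝ (fun z => (F z).det) y := by
  simp only [Matrix.det_apply]
  refine DifferentiableAt.fun_sum fun τ _ => DifferentiableAt.const_smul ?_ _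
  exact DifferentiableAt.fun_finsetProd fun i _ => hF _ _

theorem differentiableAt_inv {F : ℝ → Matrix n n ℂ}
    (hF : ∀ i j, DifferentiableAt ℝ (fun z => F z i j) y) (hdet : (F y).det ≠ 0) (i j : n) :
    DifferentiableAt ℝ (fun z => (F z)⁻¹ i j) y := by
  simp only [Matrix.inv_def, Ring.inverse_eq_inv', Matrix.smul_apply, Matrix.adjugate_apply,
    smul_eq_mul]
  refine ((differentiableAt_det hF).inv hdet).mul (differentiableAt_det fun a b => ?_)
  by_cases h : a = j
  · subst h
    simp
  · simpa [Matrix.updateRow_ne h] using hF a b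

theorem inv {F : ℝ → Matrix n n ℂ} {F' : Matrix n n ℂ} (hF : HasEntryDerivAt F F' y)
    (hdet : ∀ z, (F z).det ≠ 0) :
    HasEntryDerivAt (fun z => (F z)⁻¹) (-((F y)⁻¹ * F' * (F y)⁻¹)) y := by
  have hunit z : IsUnit (F z).det := (hdet z).isUnit
  set D : Matrix n n ℂ := Matrix.of fun i j => deriv (fun z => (F z)⁻¹ i j) y
  have hD : HasEntryDerivAt (fun z => (F z)⁻¹) D y := fun i j =>
    (differentiableAt_inv (fun a b => (hF a b).differentiableAt) (hdet y) i j).hasDerivAt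
  have hone : D * F y + (F y)⁻¹ * F' = 0 :=
    (hD.mul hF).unique (by simpa [Matrix.nonsing_inv_mul _ (hunit _)] using const 1)
  have hval : D = -((F y)⁻¹ * F' * (F y)⁻¹) := by
    rw [← Matrix.mul_one D, ← Matrix.mul_nonsing_inv _ (hunit y), ← Matrix.mul_assoc,
      eq_neg_of_add_eq_zero_left hone, Matrix.neg_mul]
  exact hD.congr_deriv hval

end HasEntryDerivAt

section CauchyMatrix

variable {N : ℕ}

/-- The solution `M` of the Sylvester equation `M A - A† M = X† G X`, `A = diag ζ`. -/
def cauchyMatrix (ζ : Fin N → ℂ) (G : Matrix (Fin 2) (Fin 2) ℂ) (X : Matrix (Fin 2) (Fin N) ℂ) :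
    Matrix (Fin N) (Fin N) ℂ :=
  Matrix.of fun j k => (Xᴴ * G * X) j k / (ζ k - star (ζ j))

/-- The moments `X Aᵏ M⁻¹ (A†)ᵐ X†` of the inverse Cauchy matrix, `A = diag ζ`. -/
def cauchyMoment (ζ : Fin N → ℂ) (G : Matrix (Fin 2) (Fin 2) ℂ) (X : Matrix (Fin 2) (Fin N) ℂ)
    (k m : ℕ) : Matrix (Fin 2) (Fin 2) ℂ :=
  X * diagonal ζ ^ k * (cauchyMatrix ζ G X)⁻¹ * (diagonal ζ)ᴴ ^ m * Xᴴ

variable {ζ : Fin N → ℂ} {G : Matrix (Fin 2) (Fin 2) ℂ}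

theorem cauchyMatrix_sylvester (hζ : ∀ i j, ζ i ≠ star (ζ j)) (X : Matrix (Fin 2) (Fin N) ℂ) :
    cauchyMatrix ζ G X * diagonal ζ - (diagonal ζ)ᴴ * cauchyMatrix ζ G X = Xᴴ * G * X := by
  ext j k
  have h : ζ k - star (ζ j) ≠ 0 := sub_ne_zero.2 (hζ k j)
  rw [diagonal_conjTranspose, Matrix.sub_apply, mul_diagonal, diagonal_mul]
  simp only [cauchyMatrix, of_apply, Pi.star_apply]
  rw [mul_comm (star (ζ j)), ← mul_sub, div_mul_cancel₀ _ h]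

theorem cauchyMatrix_conjTranspose (hG : Gᴴ = G) (X : Matrix (Fin 2) (Fin N) ℂ) :
    (cauchyMatrix ζ G X)ᴴ = -cauchyMatrix ζ G X := by
  have hX : (Xᴴ * G * X)ᴴ = Xᴴ * G * X := by
    simp [conjTranspose_mul, hG, Matrix.mul_assoc]
  ext j k
  have h : star ((Xᴴ * G * X) k j) = (Xᴴ * G * X) j k := congrFun (congrFun hX j) k
  rw [conjTranspose_apply, Matrix.neg_apply, cauchyMatrix, of_apply, of_apply, star_div₀, h,
    star_sub, star_star, ← div_neg, neg_sub]

theorem cauchyMoment_conjTranspose (hG : Gᴴ = G) (X : Matrix (Fin 2) (Fin N) ℂ)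
    (hdet : (cauchyMatrix ζ G X).det ≠ 0) (k m : ℕ) :
    (cauchyMoment ζ G X k m)ᴴ = -cauchyMoment ζ G X m k := by
  have hinv : (-cauchyMatrix ζ G X)⁻¹ = -(cauchyMatrix ζ G X)⁻¹ := by
    simpa [Units.smul_def] using Matrix.inv_smul' (cauchyMatrix ζ G X) (-1 : ℂˣ) hdet.isUnit
  simp [cauchyMoment, conjTranspose_mul, conjTranspose_nonsing_inv,
    cauchyMatrix_conjTranspose hG, Matrix.mul_assoc, hinv]

theorem cauchyMoment_succ (hζ : ∀ i j, ζ i ≠ star (ζ j)) (X : Matrix (Fin 2) (Fin N) ℂ)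
    (hdet : (cauchyMatrix ζ G X).det ≠ 0) (k m : ℕ) :
    cauchyMoment ζ G X k (m + 1) =
      cauchyMoment ζ G X (k + 1) m - cauchyMoment ζ G X k 0 * G * cauchyMoment ζ G X 0 m := by
  have hsyl := cauchyMatrix_sylvester (G := G) hζ X
  have hunit := hdet.isUnit
  have hres : (cauchyMatrix ζ G X)⁻¹ * (diagonal ζ)ᴴ = diagonal ζ * (cauchyMatrix ζ G X)⁻¹ -
      (cauchyMatrix ζ G X)⁻¹ * (Xᴴ * G * X) * (cauchyMatrix ζ G X)⁻¹ := by
    rw [← hsyl, Matrix.mul_sub, Matrix.sub_mul, nonsing_inv_mul_cancel_left _ _ hunit,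
      ← Matrix.mul_assoc, mul_nonsing_inv_cancel_right _ _ hunit, sub_sub_cancel]
  calc cauchyMoment ζ G X k (m + 1)
      = X * diagonal ζ ^ k * ((cauchyMatrix ζ G X)⁻¹ * (diagonal ζ)ᴴ) * (diagonal ζ)ᴴ ^ m * Xᴴ := by
        simp only [cauchyMoment, pow_succ', Matrix.mul_assoc]
    _ = _ := by
        rw [hres]
        simp only [cauchyMoment, pow_succ, pow_zero, Matrix.mul_one, Matrix.mul_sub,
          Matrix.sub_mul, Matrix.mul_assoc]

theorem cauchyMatrix_hasEntryDerivAt (hζ : ∀ i j, ζ i ≠ star (ζ j))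
    {σ : Matrix (Fin 2) (Fin 2) ℂ} (hσ : σᴴ = σ) (hσG : σ * G = G * σ) {κ : ℂ} (hκ : star κ = -κ)
    {r : ℕ} {X : ℝ → Matrix (Fin 2) (Fin N) ℂ} {y : ℝ}
    (hX : HasEntryDerivAt X (κ • (σ * X y * diagonal ζ ^ r)) y) :
    HasEntryDerivAt (fun z => cauchyMatrix ζ G (X z))
      (κ • ∑ l ∈ Finset.range r,
        (diagonal ζ)ᴴ ^ (r - 1 - l) * ((X y)ᴴ * (G * σ) * X y) * diagonal ζ ^ l) y := by
  intro j k
  have h : ζ k - star (ζ j) ≠ 0 := sub_ne_zero.2 (hζ k j)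
  have hprod := ((hX.conjTranspose.mul (HasEntryDerivAt.const G)).mul hX) j k
  refine (hprod.div_const (ζ k - star (ζ j))).congr_deriv ?_
  have hexp : ((κ • (σ * X y * diagonal ζ ^ r))ᴴ * G + (X y)ᴴ * (0 : Matrix (Fin 2) (Fin 2) ℂ)) * X y +
      (X y)ᴴ * G * (κ • (σ * X y * diagonal ζ ^ r)) =
      κ • ((X y)ᴴ * (G * σ) * X y * diagonal ζ ^ r -
        (diagonal ζ)ᴴ ^ r * ((X y)ᴴ * (G * σ) * X y)) := by
    have hcomm (Y : Matrix (Fin 2) (Fin N) ℂ) : σ * (G * Y) = G * (σ * Y) := by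
      rw [← Matrix.mul_assoc, hσG, Matrix.mul_assoc]
    simp only [hcomm, conjTranspose_smul, conjTranspose_mul, conjTranspose_pow, hσ, hκ, Matrix.mul_zero,
      add_zero, Matrix.mul_smul, Matrix.smul_mul, smul_sub, neg_smul, Matrix.neg_mul,
      Matrix.mul_assoc]
    abel
  rw [hexp, div_eq_iff h]
  simp only [diagonal_conjTranspose, diagonal_pow, Matrix.smul_apply, Matrix.sub_apply,
    Matrix.sum_apply, mul_diagonal, diagonal_mul, Pi.pow_apply, Pi.star_apply, smul_eq_mul]
  rw [mul_assoc]
  congr 1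
  rw [mul_comm (star (ζ j) ^ r), ← mul_sub, ← geom_sum₂_mul, ← mul_assoc, Finset.mul_sum]
  congr 1
  refine Finset.sum_congr rfl fun l _ => ?_
  ring

theorem cauchyMoment_hasEntryDerivAt (hζ : ∀ i j, ζ i ≠ star (ζ j))
    {σ : Matrix (Fin 2) (Fin 2) ℂ} (hσ : σᴴ = σ) (hσG : σ * G = G * σ) {κ : ℂ} (hκ : star κ = -κ)
    {r : ℕ} {X : ℝ → Matrix (Fin 2) (Fin N) ℂ} {y : ℝ}
    (hX : HasEntryDerivAt X (κ • (σ * X y * diagonal ζ ^ r)) y)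
    (hdet : ∀ z, (cauchyMatrix ζ G (X z)).det ≠ 0) (k m : ℕ) :
    HasEntryDerivAt (fun z => cauchyMoment ζ G (X z) k m)
      (κ • (σ * cauchyMoment ζ G (X y) (k + r) m - cauchyMoment ζ G (X y) k (m + r) * σ -
        ∑ l ∈ Finset.range r, cauchyMoment ζ G (X y) k (r - 1 - l) * (G * σ) *
          cauchyMoment ζ G (X y) l m)) y := by
  have hL := (cauchyMatrix_hasEntryDerivAt hζ hσ hσG hκ hX).inv hdet
  have h := (((hX.mul (.const (diagonal ζ ^ k))).mul hL).mul
    (.const ((diagonal ζ)ᴴ ^ m))).mul hX.conjTranspose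
  refine h.congr_deriv ?_
  rw [add_comm k r]
  simp only [cauchyMoment, conjTranspose_smul, conjTranspose_mul, conjTranspose_pow, hσ, hκ,
    Matrix.mul_zero, add_zero, Matrix.mul_smul, Matrix.smul_mul, smul_sub, neg_smul,
    Matrix.add_mul, Matrix.neg_mul, Matrix.mul_neg, Matrix.mul_sum, Matrix.sum_mul,
    Matrix.mul_assoc, pow_add, Finset.smul_sum]
  abel

end CauchyMatrix

theorem det_bordered {N : ℕ} (M : Matrix (Fin N) (Fin N) ℂ) (hM : M.det ≠ 0) (c r : Fin N → ℂ) :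
    (bordered M c r).det = -(M.det * (r ⬝ᵥ M⁻¹ *ᵥ c)) := by
  have hblocks : (bordered M c r).submatrix finSumFinEquiv finSumFinEquiv =
      fromBlocks M (replicateCol (Fin 1) c) (replicateRow (Fin 1) r) 0 := by
    have hcast (j : Fin N) : Fin.castAdd 1 j = j.castSucc := rfl
    have hlast : Fin.natAdd N (0 : Fin 1) = Fin.last N := rfl
    ext i j
    rcases i with i | i <;> rcases j with j | j <;>
      simp [bordered, finSumFinEquiv, Fin.fin_one_eq_zero, hcast, hlast]
  have := invertibleOfIsUnitDet M hM.isUnit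
  rw [← det_submatrix_equiv_self finSumFinEquiv, hblocks, det_fromBlocks₁₁, det_fin_one,
    invOf_eq_nonsing_inv, Matrix.mul_assoc]
  simp [Matrix.mul_apply, dotProduct, mulVec]

theorem contDiff_det {E n : Type*} [NormedAddCommGroup E] [NormedSpace ℝ E] [Fintype n]
    [DecidableEq n] {k : WithTop ℕ∞} {F : E → Matrix n n ℂ}
    (hF : ∀ i j, ContDiff ℝ k fun p => F p i j) : ContDiff ℝ k fun p => (F p).det := by
  simp only [Matrix.det_apply]
  exact ContDiff.sum fun τ _ => (contDiff_prod fun i _ => hF _ _).const_smul _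

theorem contDiff_bordered_det_div {N : ℕ} {k : WithTop ℕ∞}
    {M : ℝ × ℝ → Matrix (Fin N) (Fin N) ℂ} {c r : ℝ × ℝ → Fin N → ℂ}
    (hM : ∀ i j, ContDiff ℝ k fun p => M p i j) (hdet : ∀ p, (M p).det ≠ 0)
    (hc : ∀ i, ContDiff ℝ k fun p => c p i) (hr : ∀ i, ContDiff ℝ k fun p => r p i) (a : ℂ) :
    ContDiff ℝ k fun p => a * (bordered (M p) (c p) (r p)).det / (M p).det := by
  simp only [div_eq_mul_inv]
  refine (contDiff_const.mul (contDiff_det fun i j => ?_)).mul ((contDiff_det hM).inv hdet)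
  refine Fin.lastCases ?_ (fun i' => ?_) i <;> refine Fin.lastCases ?_ (fun j' => ?_) j
  · simpa [bordered] using contDiff_const
  · simpa [bordered] using hr j'
  · simpa [bordered] using hc i'
  · simpa [bordered] using hM i' j'

theorem dX_const_mul (c : ℂ) (f : ℝ × ℝ → ℂ) :
    dX (fun p => c * f p) = fun p => c * dX f p :=
  funext fun _ => deriv_const_mul_field _

theorem dT_const_mul (c : ℂ) (f : ℝ × ℝ → ℂ) :
    dT (fun p => c * f p) = fun p => c * dT f p :=
  funext fun _ => deriv_const_mul_field _

/-- Real multiples `c₁ s, c₂ s, c₃ s` of a solution `s` of the scalar complex mKdV equation with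
coupling `c₁² + c₂² + c₃²` solve the vcmKdV equation. -/
theorem vcmKdVeq_of_scalar {s : ℝ × ℝ → ℂ} {c₁ c₂ c₃ : ℝ}
    (hs : ∀ p, dT s p + dX (dX (dX s)) p +
      6 * (c₁ ^ 2 + c₂ ^ 2 + c₃ ^ 2) * (star (s p) * s p) * dX s p = 0) :
    vcmKdVeq (fun p => c₁ * s p) (fun p => c₂ * s p) (fun p => c₃ * s p) := by
  intro p
  have h := hs p
  simp only [Complex.star_def] at h
  simp only [vcmLHS, dX_const_mul, dT_const_mul, map_mul, Complex.conj_ofReal]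
  refine ⟨?_, ?_, ?_⟩
  · linear_combination c₁ * h
  · linear_combination c₂ * h
  · linear_combination c₃ * h

section ScalarReduction

/-- The third Pauli matrix. -/
def pauliZ : Matrix (Fin 2) (Fin 2) ℂ := diagonal ![1, -1]

/-- The weight `diag(1, C)` of the inner product on the reduced eigenfunctions. -/
def couplingMatrix (C : ℝ) : Matrix (Fin 2) (Fin 2) ℂ := diagonal ![1, (C : ℂ)]

theorem pauliZ_apply (i j : Fin 2) :
    pauliZ i j = (diagonal ![1, -1] : Matrix (Fin 2) (Fin 2) ℂ) i j :=
  rfl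

theorem couplingMatrix_apply (C : ℝ) (i j : Fin 2) :
    couplingMatrix C i j = (diagonal ![1, (C : ℂ)] : Matrix (Fin 2) (Fin 2) ℂ) i j :=
  rfl

theorem pauliZ_conjTranspose : pauliZᴴ = pauliZ := by
  ext i j
  fin_cases i <;> fin_cases j <;> simp [pauliZ]

theorem couplingMatrix_conjTranspose (C : ℝ) : (couplingMatrix C)ᴴ = couplingMatrix C := by
  ext i j
  fin_cases i <;> fin_cases j <;> simp [couplingMatrix]

theorem pauliZ_mul_couplingMatrix (C : ℝ) :
    pauliZ * couplingMatrix C = couplingMatrix C * pauliZ := by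
  simp [pauliZ, couplingMatrix, diagonal_mul_diagonal, mul_comm]

variable {N : ℕ} {ζ : Fin N → ℂ} {C : ℝ} {X : ℝ × ℝ → Matrix (Fin 2) (Fin N) ℂ}

theorem cauchyMoment_hasEntryDerivAt_fst (hζ : ∀ i j, ζ i ≠ star (ζ j))
    (hX : ∀ p : ℝ × ℝ, HasEntryDerivAt (fun x => X (x, p.2))
      ((-Complex.I) • (pauliZ * X p * diagonal ζ ^ 1)) p.1)
    (hdet : ∀ p, (cauchyMatrix ζ (couplingMatrix C) (X p)).det ≠ 0) (k : ℕ) (p : ℝ × ℝ) :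
    HasEntryDerivAt (fun x => cauchyMoment ζ (couplingMatrix C) (X (x, p.2)) k 0)
      (let S := fun k => cauchyMoment ζ (couplingMatrix C) (X p) k 0
       !![-2 * Complex.I * C * S k 0 1 * S 0 1 0,
          -2 * Complex.I * S (k + 1) 0 1 + 2 * Complex.I * S k 0 0 * S 0 0 1;
          2 * Complex.I * S (k + 1) 1 0 - 2 * Complex.I * C * S k 1 1 * S 0 1 0,
          2 * Complex.I * S k 1 0 * S 0 0 1]) p.1 := by
  have h := cauchyMoment_hasEntryDerivAt hζ pauliZ_conjTranspose (pauliZ_mul_couplingMatrix C)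
    (by simp) (hX p) (fun x => hdet (x, p.2)) k 0
  refine h.congr_deriv ?_
  have hs := cauchyMoment_succ hζ (X p) (hdet p) k 0
  rw [zero_add] at hs
  ext i j
  fin_cases i <;> fin_cases j <;>
    simp [hs, Matrix.mul_apply, Fin.sum_univ_two, pauliZ_apply, couplingMatrix_apply] <;> ring

theorem cauchyMoment_hasDerivAt_snd (hζ : ∀ i j, ζ i ≠ star (ζ j))
    (hX : ∀ p : ℝ × ℝ, HasEntryDerivAt (fun t => X (p.1, t))
      ((-4 * Complex.I) • (pauliZ * X p * diagonal ζ ^ 3)) p.2)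
    (hdet : ∀ p, (cauchyMatrix ζ (couplingMatrix C) (X p)).det ≠ 0) (p : ℝ × ℝ) :
    HasDerivAt (fun t => cauchyMoment ζ (couplingMatrix C) (X (p.1, t)) 0 0 0 1)
      (let S := fun k => cauchyMoment ζ (couplingMatrix C) (X p) k 0;
       -8 * Complex.I * (S 3 0 1 - S 2 0 0 * S 0 0 1 - S 1 0 0 * S 1 0 1 - S 0 0 0 * S 2 0 1
         + (2 * S 0 0 0 * S 1 0 0 + C * (S 1 0 1 * S 0 1 0 + S 0 0 1 * S 1 1 0)) * S 0 0 1
         + (S 0 0 0 ^ 2 + C * S 0 0 1 * S 0 1 0) * (S 1 0 1 - S 0 0 0 * S 0 0 1)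
         - C * S 0 0 1 * S 0 1 0 * (S 0 0 0 + C * S 0 1 1) * S 0 0 1)) p.2 := by
  have h := cauchyMoment_hasEntryDerivAt hζ pauliZ_conjTranspose (pauliZ_mul_couplingMatrix C)
    (by simp) (hX p) (fun t => hdet (p.1, t)) 0 0
  refine (h 0 1).congr_deriv ?_
  have hs := cauchyMoment_succ hζ (X p) (hdet p)
  simp [Finset.sum_range_succ, hs 0 2, hs 1 1, hs 2 0, hs 0 1, hs 1 0, hs 0 0,
    Matrix.mul_apply, Fin.sum_univ_two, pauliZ_apply, couplingMatrix_apply]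
  ring

/-- The off-diagonal entry of the zeroth moment solves the complex mKdV equation. -/
theorem cauchyMoment_cmKdV (hζ : ∀ i j, ζ i ≠ star (ζ j))
    (hx : ∀ p : ℝ × ℝ, HasEntryDerivAt (fun x => X (x, p.2))
      ((-Complex.I) • (pauliZ * X p * diagonal ζ ^ 1)) p.1)
    (ht : ∀ p : ℝ × ℝ, HasEntryDerivAt (fun t => X (p.1, t))
      ((-4 * Complex.I) • (pauliZ * X p * diagonal ζ ^ 3)) p.2)
    (hdet : ∀ p, (cauchyMatrix ζ (couplingMatrix C) (X p)).det ≠ 0) (p : ℝ × ℝ) :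
    let s := fun p => -2 * Complex.I * cauchyMoment ζ (couplingMatrix C) (X p) 0 0 0 1
    dT s p + dX (dX (dX s)) p + 6 * C * (star (s p) * s p) * dX s p = 0 := by
  intro s
  set S : Fin 2 → Fin 2 → ℕ → ℝ × ℝ → ℂ :=
    fun i j k p => cauchyMoment ζ (couplingMatrix C) (X p) k 0 i j with hS
  have hF k p : HasDerivAt (fun x => S 0 0 k (x, p.2))
      (-2 * Complex.I * C * S 0 1 k p * S 1 0 0 p) p.1 :=
    cauchyMoment_hasEntryDerivAt_fst hζ hx hdet k p 0 0
  have hH k p : HasDerivAt (fun x => S 0 1 k (x, p.2))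
      (-2 * Complex.I * S 0 1 (k + 1) p + 2 * Complex.I * S 0 0 k p * S 0 1 0 p) p.1 :=
    cauchyMoment_hasEntryDerivAt_fst hζ hx hdet k p 0 1
  have hR k p : HasDerivAt (fun x => S 1 0 k (x, p.2))
      (2 * Complex.I * S 1 0 (k + 1) p - 2 * Complex.I * C * S 1 1 k p * S 1 0 0 p) p.1 :=
    cauchyMoment_hasEntryDerivAt_fst hζ hx hdet k p 1 0
  have hT := (cauchyMoment_hasDerivAt_snd hζ ht hdet p).deriv
  have hstar : star (S 0 1 0 p) = -S 1 0 0 p :=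
    congrFun (congrFun (cauchyMoment_conjTranspose (couplingMatrix_conjTranspose C) (X p)
      (hdet p) 0 0) 1) 0
  have hs : s = fun p => -2 * Complex.I * S 0 1 0 p := rfl
  have h1 : dX (S 0 1 0) = fun p =>
      -2 * Complex.I * S 0 1 1 p + 2 * Complex.I * (S 0 0 0 p * S 0 1 0 p) :=
    funext fun p => (hH 0 p).deriv.trans (by ring)
  have h2 : dX (dX (S 0 1 0)) = fun p => -4 * S 0 1 2 p + 4 * (S 0 0 1 p * S 0 1 0 p)
      + 4 * C * (S 0 1 0 p ^ 2 * S 1 0 0 p) + 4 * (S 0 0 0 p * S 0 1 1 p)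
      - 4 * (S 0 0 0 p ^ 2 * S 0 1 0 p) := by
    rw [h1]
    funext p
    refine ((((hH 1 p).const_mul _).add (((hF 0 p).mul (hH 0 p)).const_mul _)).deriv).trans ?_
    simp only [Prod.mk.eta]
    ring_nf
    simp only [Complex.I_sq]
    ring
  have h3 : dX (dX (dX (S 0 1 0))) p =
      8 * Complex.I * (S 0 1 3 p - S 0 0 2 p * S 0 1 0 p - C * S 0 1 1 p * S 1 0 0 p * S 0 1 0 p
        + S 0 0 1 p * (S 0 0 0 p * S 0 1 0 p - S 0 1 1 p)
        + 2 * C * S 0 1 0 p * S 1 0 0 p * (S 0 0 0 p * S 0 1 0 p - S 0 1 1 p)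
        + C * S 0 1 0 p ^ 2 * (S 1 0 1 p - C * S 1 1 0 p * S 1 0 0 p)
        - C * S 0 1 0 p * S 1 0 0 p * S 0 1 1 p
        + S 0 0 0 p * (S 0 0 1 p * S 0 1 0 p - S 0 1 2 p)
        + 2 * C * S 0 0 0 p * S 0 1 0 p ^ 2 * S 1 0 0 p
        - S 0 0 0 p ^ 2 * (S 0 0 0 p * S 0 1 0 p - S 0 1 1 p)) := by
    rw [h2]
    refine (((((((hH 2 p).const_mul (-4 : ℂ)).add
      (((hF 1 p).mul (hH 0 p)).const_mul (4 : ℂ))).add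
      ((((hH 0 p).pow 2).mul (hR 0 p)).const_mul (4 * C : ℂ))).add
      (((hF 0 p).mul (hH 1 p)).const_mul (4 : ℂ))).sub
      ((((hF 0 p).pow 2).mul (hH 0 p)).const_mul (4 : ℂ))).deriv).trans ?_
    simp only [Prod.mk.eta, Nat.cast_ofNat, Nat.add_one_sub_one, pow_one, Pi.pow_apply]
    ring
  have hnorm : star (s p) * s p = -4 * (S 1 0 0 p * S 0 1 0 p) := by
    simp only [hs, star_mul', star_neg, hstar, Complex.star_def, Complex.conj_I, map_ofNat]
    linear_combination 4 * (S 1 0 0 p * S 0 1 0 p) * Complex.I_sq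
  have hT' : dT (S 0 1 0) p = _ := hT
  rw [hnorm, hs]
  simp only [dX_const_mul, dT_const_mul]
  rw [h3, hT', h1]
  simp only [hS]
  ring

end ScalarReduction

section ZeroSeed

variable {N : ℕ}

/-- The first component and the common factor of the remaining components of the zero-seed
eigenfunctions, as the two rows of a matrix. -/
def seedRows (ζ : Fin N → ℂ) (p : ℝ × ℝ) : Matrix (Fin 2) (Fin N) ℂ :=
  Matrix.of ![fun j => Complex.exp (-Complex.I * ζ j * (4 * p.2 * ζ j ^ 2 + p.1)),
    fun j => Complex.exp (Complex.I * ζ j * (4 * p.2 * ζ j ^ 2 + p.1))]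

theorem seedRows_hasEntryDerivAt_fst (ζ : Fin N → ℂ) (p : ℝ × ℝ) :
    HasEntryDerivAt (fun x => seedRows ζ (x, p.2))
      ((-Complex.I) • (pauliZ * seedRows ζ p * diagonal ζ ^ 1)) p.1 := by
  have h (a b : ℂ) : HasDerivAt (fun x : ℝ => Complex.exp (a * (b + x)))
      (Complex.exp (a * (b + p.1)) * a) p.1 := by
    simpa using (((hasDerivAt_id p.1).ofReal_comp.const_add b).const_mul a).cexp
  intro i j
  fin_cases i
  · refine (h (-Complex.I * ζ j) (4 * p.2 * ζ j ^ 2)).congr_deriv ?_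
    simp [seedRows, pauliZ, mul_diagonal, diagonal_mul]
    ring
  · refine (h (Complex.I * ζ j) (4 * p.2 * ζ j ^ 2)).congr_deriv ?_
    simp [seedRows, pauliZ, mul_diagonal, diagonal_mul]
    ring

theorem seedRows_hasEntryDerivAt_snd (ζ : Fin N → ℂ) (p : ℝ × ℝ) :
    HasEntryDerivAt (fun t => seedRows ζ (p.1, t))
      ((-4 * Complex.I) • (pauliZ * seedRows ζ p * diagonal ζ ^ 3)) p.2 := by
  have h (a b c : ℂ) : HasDerivAt (fun t : ℝ => Complex.exp (a * (4 * t * b + c)))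
      (Complex.exp (a * (4 * p.2 * b + c)) * (a * (4 * b))) p.2 := by
    simpa using (((((hasDerivAt_id p.2).ofReal_comp.const_mul 4).mul_const b).add_const c).const_mul
      a).cexp
  intro i j
  fin_cases i
  · refine (h (-Complex.I * ζ j) (ζ j ^ 2) p.1).congr_deriv ?_
    simp [seedRows, pauliZ, mul_diagonal, diagonal_mul, diagonal_pow]
    ring
  · refine (h (Complex.I * ζ j) (ζ j ^ 2) p.1).congr_deriv ?_
    simp [seedRows, pauliZ, mul_diagonal, diagonal_mul, diagonal_pow]
    ring

theorem contDiff_seedPsi {k : WithTop ℕ∞} (ζ : ℂ) (c₁ c₂ c₃ : ℝ) (a : Fin 4) :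
    ContDiff ℝ k fun p => seedPsi ζ c₁ c₂ c₃ p a := by
  have hfst : ContDiff ℝ k fun p : ℝ × ℝ => (p.1 : ℂ) :=
    Complex.ofRealCLM.contDiff.comp contDiff_fst
  have hsnd : ContDiff ℝ k fun p : ℝ × ℝ => (p.2 : ℂ) :=
    Complex.ofRealCLM.contDiff.comp contDiff_snd
  fin_cases a <;> simp only [seedPsi] <;> dsimp <;> fun_prop

theorem contDiff_conj_seedPsi {k : WithTop ℕ∞} (ζ : ℂ) (c₁ c₂ c₃ : ℝ) (a : Fin 4) :
    ContDiff ℝ k fun p => (starRingEnd ℂ) (seedPsi ζ c₁ c₂ c₃ p a) :=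
  Complex.conjCLE.contDiff.comp (contDiff_seedPsi ζ c₁ c₂ c₃ a)

theorem contDiff_MmatOf_seedPsi {k : WithTop ℕ∞} (ζ : Fin N → ℂ) (c₁ c₂ c₃ : ℝ) (i j : Fin N) :
    ContDiff ℝ k fun p => MmatOf ζ (fun j p => seedPsi (ζ j) c₁ c₂ c₃ p) p i j := by
  simp only [MmatOf, of_apply, dotProduct, Pi.star_apply]
  exact (ContDiff.sum fun a _ =>
    (contDiff_conj_seedPsi _ _ _ _ a).mul (contDiff_seedPsi _ _ _ _ a)).div_const _

theorem MmatOf_seedPsi (ζ : Fin N → ℂ) (c₁ c₂ c₃ : ℝ) (p : ℝ × ℝ) :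
    MmatOf ζ (fun j p => seedPsi (ζ j) c₁ c₂ c₃ p) p =
      cauchyMatrix ζ (couplingMatrix (c₁ ^ 2 + c₂ ^ 2 + c₃ ^ 2)) (seedRows ζ p) := by
  ext j k
  simp only [MmatOf, cauchyMatrix, of_apply, Complex.star_def]
  congr 1
  simp [seedPsi, seedRows, couplingMatrix, dotProduct, Fin.sum_univ_four, Matrix.mul_apply,
    Fin.sum_univ_two]
  ring

theorem bordered_det_div_seedPsi (ζ : Fin N → ℂ) (c₁ c₂ c₃ : ℝ) (p : ℝ × ℝ)
    (hdet : (MmatOf ζ (fun j p => seedPsi (ζ j) c₁ c₂ c₃ p) p).det ≠ 0) (a : Fin 4) (c : ℝ)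
    (ha : ∀ j, seedPsi (ζ j) c₁ c₂ c₃ p a = c * seedRows ζ p 1 j) :
    2 * Complex.I * (bordered (MmatOf ζ (fun j p => seedPsi (ζ j) c₁ c₂ c₃ p) p)
        (fun j => (starRingEnd ℂ) (seedPsi (ζ j) c₁ c₂ c₃ p a))
        (fun j => seedPsi (ζ j) c₁ c₂ c₃ p 0)).det /
      (MmatOf ζ (fun j p => seedPsi (ζ j) c₁ c₂ c₃ p) p).det =
    c * (-2 * Complex.I *
      cauchyMoment ζ (couplingMatrix (c₁ ^ 2 + c₂ ^ 2 + c₃ ^ 2)) (seedRows ζ p) 0 0 0 1) := by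
  rw [det_bordered _ hdet, div_eq_iff hdet]
  have hmoment : (fun j => seedPsi (ζ j) c₁ c₂ c₃ p 0) ⬝ᵥ
      (MmatOf ζ (fun j p => seedPsi (ζ j) c₁ c₂ c₃ p) p)⁻¹ *ᵥ
        (fun j => (starRingEnd ℂ) (seedPsi (ζ j) c₁ c₂ c₃ p a)) =
      c * cauchyMoment ζ (couplingMatrix (c₁ ^ 2 + c₂ ^ 2 + c₃ ^ 2)) (seedRows ζ p) 0 0 0 1 := by
    have hcol : (fun j => (starRingEnd ℂ) (seedPsi (ζ j) c₁ c₂ c₃ p a)) =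
        (c : ℂ) • fun j => (seedRows ζ p)ᴴ j 1 := by
      funext j
      simp [ha]
    rw [hcol, mulVec_smul, dotProduct_smul, smul_eq_mul, MmatOf_seedPsi]
    congr 1
    simp only [cauchyMoment, pow_zero, Matrix.mul_one, Matrix.mul_assoc]
    rfl
  rw [hmoment]
  ring

end ZeroSeed

/-- the `N`-bright-bright-bright soliton solution obtained from
the zero seed by the `N`-fold Darboux transformation solves the vcmKdV
equation. -/
theorem N_bright_soliton (N : ℕ) (ζs : Fin N → ℂ)
    (hdist : ∀ i j, i ≠ j → ζs i ≠ ζs j)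
    (hnc : ∀ i j, ζs i ≠ (starRingEnd ℂ) (ζs j))
    (c₁ c₂ c₃ : ℝ) (hc : ¬(c₁ = 0 ∧ c₂ = 0 ∧ c₃ = 0))
    (Ψs : Fin N → ℝ × ℝ → Fin 4 → ℂ)
    (hΨ : Ψs = fun j p => seedPsi (ζs j) c₁ c₂ c₃ p)
    (hM : ∀ p : ℝ × ℝ, (MmatOf ζs Ψs p).det ≠ 0)
    (uN vN wN : ℝ × ℝ → ℂ)
    (huN : uN = fun p => 2 * Complex.I
      * (bordered (MmatOf ζs Ψs p)
          (fun j => (starRingEnd ℂ) (Ψs j p 1)) (fun j => Ψs j p 0)).det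
      / (MmatOf ζs Ψs p).det)
    (hvN : vN = fun p => 2 * Complex.I
      * (bordered (MmatOf ζs Ψs p)
          (fun j => (starRingEnd ℂ) (Ψs j p 2)) (fun j => Ψs j p 0)).det
      / (MmatOf ζs Ψs p).det)
    (hwN : wN = fun p => 2 * Complex.I
      * (bordered (MmatOf ζs Ψs p)
          (fun j => (starRingEnd ℂ) (Ψs j p 3)) (fun j => Ψs j p 0)).det
      / (MmatOf ζs Ψs p).det) :
    ContDiff ℝ (⊤ : ℕ∞) uN ∧ ContDiff ℝ (⊤ : ℕ∞) vN ∧ ContDiff ℝ (⊤ : ℕ∞) wN ∧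
    vcmKdVeq uN vN wN := by
  subst hΨ huN hvN hwN
  have hsmooth (a : Fin 4) := contDiff_bordered_det_div (k := (⊤ : ℕ∞))
    (contDiff_MmatOf_seedPsi ζs c₁ c₂ c₃) hM (fun i => contDiff_conj_seedPsi (ζs i) c₁ c₂ c₃ a)
    (fun i => contDiff_seedPsi (ζs i) c₁ c₂ c₃ 0) (2 * Complex.I)
  refine ⟨hsmooth 1, hsmooth 2, hsmooth 3, ?_⟩
  have hscalar := cauchyMoment_cmKdV (C := c₁ ^ 2 + c₂ ^ 2 + c₃ ^ 2) hnc
    (seedRows_hasEntryDerivAt_fst ζs) (seedRows_hasEntryDerivAt_snd ζs)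
    (fun p => MmatOf_seedPsi ζs c₁ c₂ c₃ p ▸ hM p)
  have hbordered p a := bordered_det_div_seedPsi ζs c₁ c₂ c₃ p (hM p) a
  simp only [hbordered _ 1 c₁ fun _ => rfl, hbordered _ 2 c₂ fun _ => rfl,
    hbordered _ 3 c₃ fun _ => rfl]
  refine vcmKdVeq_of_scalar fun p => ?_
  simpa only [Complex.ofReal_add, Complex.ofReal_pow] using hscalar p

end
end
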